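/- Under the standing assumptions, there exist κ > 0 and C > 0 such that for every n ≥ 1, every ρ ∈ [e^{−n}, 1), and every (a, b, c) ∈ ℝ³ with max(|a|, |b|, |c|) = 1: σ^{(n)}({s ∈ ℝ : |a s² + b s + c| ≤ ρ}) ≤ C ρ^κ. -/

import Mathlib

open MeasureTheory Filter Topology

/-- The group of orientation-preserving affine maps of ℝ, modeled as pairs `(r, b)`
with `r > 0`, acting by `t ↦ r * t + b`. -/
abbrev AffP : Type := {p : ℝ × ℝ // 0 < p.1}

/-- The topological support of a measure. -/
def msupport {α : Type*} [TopologicalSpace α] [MeasurableSpace α] (μ : Measure α) : Set α :=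
  {x | ∀ U : Set α, IsOpen U → x ∈ U → 0 < μ U}

/-- `iterLaw lam n` is the law `σ⁽ⁿ⁾` of `(φ₁ ∘ ⋯ ∘ φₙ)(0)` where `φ₁, …, φₙ` are
i.i.d. with law `lam`; `iterLaw lam 0 = δ₀`. -/
noncomputable def iterLaw (lam : Measure AffP) : ℕ → Measure ℝ
  | 0 => Measure.dirac 0
  | n + 1 =>
      Measure.map (fun p : AffP × ℝ => p.1.1.1 * p.2 + p.1.1.2) (lam.prod (iterLaw lam n))

/-- The inverse affine map: `pull φ y` is the point sent to `y` by `φ`. -/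
noncomputable def pull (φ : AffP) (y : ℝ) : ℝ := (y - φ.1.2) / φ.1.1

lemma pull_le_pull (φ : AffP) {x y : ℝ} (h : x ≤ y) : pull φ x ≤ pull φ y := by
  unfold pull
  have := φ.2
  gcongr

lemma pull_injective (φ : AffP) : Function.Injective (pull φ) := by
  intro x y h
  have := φ.2.ne'
  unfold pull at h
  field_simp at h
  linarith

lemma apply_pull (φ : AffP) (y : ℝ) : φ.1.1 * pull φ y + φ.1.2 = y := by
  have := φ.2.ne'
  unfold pull
  field_simp
  ring

lemma measurable_pull : Measurable (fun p : ℝ × AffP => pull p.2 p.1) := by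
  unfold pull
  fun_prop

lemma measurable_pull_left (y : ℝ) : Measurable (fun φ : AffP => pull φ y) := by
  unfold pull
  fun_prop

lemma measurable_affine_apply :
    Measurable (fun p : AffP × ℝ => p.1.1.1 * p.2 + p.1.1.2) := by
  fun_prop

lemma preimage_closedBall (φ : AffP) (y s : ℝ) :
    (fun t => φ.1.1 * t + φ.1.2) ⁻¹' Metric.closedBall y s
      = Metric.closedBall (pull φ y) (s / φ.1.1) := by
  have hr := φ.2
  ext t
  simp only [Set.mem_preimage, Metric.mem_closedBall, Real.dist_eq]
  have : φ.1.1 * t + φ.1.2 - y = φ.1.1 * (t - pull φ y) := by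
    have := apply_pull φ y
    linarith
  rw [this, abs_mul, abs_of_pos hr, le_div_iff₀ hr, mul_comm]

lemma preimage_singleton (φ : AffP) (y : ℝ) :
    (fun t => φ.1.1 * t + φ.1.2) ⁻¹' {y} = {pull φ y} := by
  have hr := φ.2.ne'
  ext t
  simp only [Set.mem_preimage, Set.mem_singleton_iff]
  constructor
  · intro h
    unfold pull
    field_simp
    linarith
  · rintro rfl
    exact apply_pull φ y

lemma not_ae_fixed {lam : Measure AffP}
    (hnofix : ¬ ∃ t : ℝ, ∀ φ ∈ msupport lam, φ.1.1 * t + φ.1.2 = t) (t : ℝ) :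
    ¬ ∀ᵐ φ ∂lam, φ.1.1 * t + φ.1.2 = t := by
  intro h
  refine hnofix ⟨t, fun φ hφ => ?_⟩
  by_contra hne
  have hopen : IsOpen {ψ : AffP | ψ.1.1 * t + ψ.1.2 ≠ t} :=
    isOpen_ne_fun (by fun_prop) (by fun_prop)
  exact (hφ _ hopen hne).ne' h

lemma iterLaw_isProbabilityMeasure (lam : Measure AffP) [IsProbabilityMeasure lam] (n : ℕ) :
    IsProbabilityMeasure (iterLaw lam n) := by
  induction n with
  | zero => unfold iterLaw; infer_instance
  | succ n ih =>
    unfold iterLaw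
    exact Measure.isProbabilityMeasure_map measurable_affine_apply.aemeasurable

lemma iterLaw_succ_apply (lam : Measure AffP) [IsProbabilityMeasure lam] (n : ℕ)
    {A : Set ℝ} (hA : MeasurableSet A) :
    iterLaw lam (n + 1) A
      = ∫⁻ φ : AffP, iterLaw lam n ((fun t => φ.1.1 * t + φ.1.2) ⁻¹' A) ∂lam := by
  have := iterLaw_isProbabilityMeasure lam n
  rw [iterLaw, Measure.map_apply measurable_affine_apply hA,
    Measure.prod_apply (measurable_affine_apply hA)]
  rfl

/-- A stationary measure of a system without common fixed point has no atoms. -/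
lemma measure_singleton_eq_zero_of_stationary {lam : Measure AffP} [IsProbabilityMeasure lam]
    (hnofix : ¬ ∃ t : ℝ, ∀ φ ∈ msupport lam, φ.1.1 * t + φ.1.2 = t)
    {σ : Measure ℝ} [IsProbabilityMeasure σ]
    (hstat : ∀ A : Set ℝ, MeasurableSet A →
      σ A = ∫⁻ φ : AffP, σ ((fun t => φ.1.1 * t + φ.1.2) ⁻¹' A) ∂lam) (x₀ : ℝ) :
    σ {x₀} = 0 := by
  by_contra hx₀
  have hfin : ∀ α : ENNReal, 0 < α → {x : ℝ | α ≤ σ {x}}.Finite := fun α hα =>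
    Measure.finite_const_le_meas_of_disjoint_iUnion σ hα (fun i => measurableSet_singleton i)
      (fun i j hij => by simpa using hij) (measure_ne_top _ _)
  obtain ⟨x₁, hx₁, hmax⟩ := Set.exists_max_image {x : ℝ | σ {x₀} ≤ σ {x}} (fun x => σ {x})
    (hfin _ (pos_iff_ne_zero.2 hx₀)) ⟨x₀, le_refl (σ {x₀})⟩
  have hx₁pos : 0 < σ {x₁} := (pos_iff_ne_zero.2 hx₀).trans_le hx₁
  have hle : ∀ x, σ {x} ≤ σ {x₁} := by
    intro x
    by_cases hx : σ {x₀} ≤ σ {x}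
    · exact hmax x hx
    · exact (not_le.1 hx).le.trans hx₁
  let A : Finset ℝ := (hfin _ hx₁pos).toFinset
  have memA : ∀ x, x ∈ A ↔ σ {x₁} ≤ σ {x} := fun x => by simp [A]
  have hA : A.Nonempty := ⟨x₁, (memA x₁).2 le_rfl⟩
  have hmeas : ∀ x : ℝ, AEMeasurable (fun φ : AffP => σ {pull φ x}) lam := by
    intro x
    have : Measurable (fun φ : AffP => σ ((fun t => φ.1.1 * t + φ.1.2) ⁻¹' {x})) :=
      measurable_measure_prodMk_left (measurable_affine_apply (measurableSet_singleton x))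
    simp_rw [preimage_singleton] at this
    exact this.aemeasurable
  have hae : ∀ x ∈ A, ∀ᵐ φ ∂lam, pull φ x ∈ A := by
    intro x hx
    have h1 := hstat {x} (measurableSet_singleton x)
    simp_rw [preimage_singleton] at h1
    have h2 : (fun φ : AffP => σ {pull φ x}) =ᵐ[lam] fun _ => σ {x₁} := by
      refine ae_eq_of_ae_le_of_lintegral_le (ae_of_all _ fun φ => hle _) ?_
        aemeasurable_const ?_
      · rw [← h1]; exact measure_ne_top _ _
      · rw [← h1]; simpa using (memA x).1 hx
    filter_upwards [h2] with φ hφ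
    exact (memA _).2 hφ.ge
  have hae' : ∀ᵐ φ ∂lam, ∀ x ∈ A, pull φ x ∈ A := (ae_ball_iff A.countable_toSet).2 hae
  refine not_ae_fixed hnofix (A.max' hA) ?_
  filter_upwards [hae'] with φ hφ
  have hsurj := Finset.surjOn_of_injOn_of_card_le (s := A) (t := A) (pull φ) hφ
    (pull_injective φ).injOn le_rfl
  obtain ⟨x, hx, hxe⟩ := hsurj (A.max'_mem hA)
  have h1 : A.max' hA ≤ pull φ (A.max' hA) := by
    rw [← hxe]
    exact pull_le_pull φ (hxe ▸ A.le_max' x hx)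
  have h2 : pull φ (A.max' hA) = A.max' hA := le_antisymm (A.le_max' _ (hφ _ (A.max'_mem hA))) h1
  have h3 := apply_pull φ (A.max' hA)
  rwa [h2] at h3

lemma exists_radius_measure_closedBall_le (σ : Measure ℝ) [IsProbabilityMeasure σ]
    {ε : ENNReal} (hε : 0 < ε) : ∃ R : ℝ, 0 < R ∧ σ (Metric.closedBall 0 R)ᶜ < ε := by
  have h := tendsto_measure_iInter_atTop (μ := σ)
    (s := fun n : ℕ => (Metric.closedBall (0 : ℝ) n)ᶜ)
    (fun n => measurableSet_closedBall.compl.nullMeasurableSet)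
    (fun m n hmn => Set.compl_subset_compl.2
      (Metric.closedBall_subset_closedBall (by exact_mod_cast hmn)))
    ⟨0, measure_ne_top _ _⟩
  have h0 : (⋂ n : ℕ, (Metric.closedBall (0 : ℝ) n)ᶜ) = ∅ := by
    rw [← Set.compl_iUnion, Metric.iUnion_closedBall_nat, Set.compl_univ]
  rw [h0, measure_empty] at h
  obtain ⟨n, hn, hn'⟩ := ((h.eventually (gt_mem_nhds hε)).and (eventually_gt_atTop 0)).exists
  exact ⟨n, by exact_mod_cast hn', hn⟩

/-- An atomless probability measure on the line gives uniformly small mass to small balls. -/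
lemma exists_pos_forall_measure_closedBall_le {σ : Measure ℝ} [IsProbabilityMeasure σ]
    (hσ : ∀ x, σ {x} = 0) {ε : ENNReal} (hε : 0 < ε) :
    ∃ s : ℝ, 0 < s ∧ ∀ y, σ (Metric.closedBall y s) ≤ ε := by
  by_contra! hcon
  obtain ⟨R, hR, hRε⟩ := exists_radius_measure_closedBall_le σ hε
  choose y hy using fun n : ℕ => hcon (1 / (n + 1 : ℝ)) (by positivity)
  have hbdd : ∀ n, y n ∈ Metric.closedBall (0 : ℝ) (R + 1) := by
    intro n
    by_contra hn
    refine (hy n).not_ge ((measure_mono ?_).trans hRε.le)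
    intro t ht
    simp only [Metric.mem_closedBall, Set.mem_compl_iff, Real.dist_eq, sub_zero] at *
    have : 1 / (n + 1 : ℝ) ≤ 1 := by
      rw [div_le_one (by positivity)]
      linarith [n.cast_nonneg (α := ℝ)]
    intro h
    refine hn ?_
    have := abs_sub_abs_le_abs_sub (y n) t
    rw [abs_sub_comm] at this
    linarith
  obtain ⟨x, -, φ, hφ, hlim⟩ := (isCompact_closedBall (0 : ℝ) (R + 1)).tendsto_subseq hbdd
  have hcont := tendsto_measure_cthickening_of_isClosed (μ := σ) (s := {x})
    ⟨1, one_pos, measure_ne_top _ _⟩ isClosed_singleton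
  rw [hσ] at hcont
  have hev : ∀ᶠ r in 𝓝[>] (0 : ℝ), σ (Metric.cthickening r {x}) < ε ∧ 0 < r :=
    ((hcont.mono_left nhdsWithin_le_nhds).eventually (gt_mem_nhds hε)).and self_mem_nhdsWithin
  obtain ⟨r, hr, hr0⟩ := hev.exists
  have h1 : ∀ᶠ n in atTop, dist (y (φ n)) x < r / 2 :=
    hlim.eventually (Metric.ball_mem_nhds x (half_pos hr0))
  have h2 : ∀ᶠ n : ℕ in atTop, 1 / ((φ n : ℝ) + 1) < r / 2 :=
    (tendsto_one_div_add_atTop_nhds_zero_nat.comp hφ.tendsto_atTop).eventually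
      (gt_mem_nhds (half_pos hr0))
  obtain ⟨n, hn1, hn2⟩ := (h1.and h2).exists
  refine (hy (φ n)).not_ge ((measure_mono ?_).trans hr.le)
  rw [Metric.cthickening_singleton x hr0.le]
  exact Metric.closedBall_subset_closedBall' (by linarith)

/-- A logarithmic gauge of the distance of `φ` to the identity. -/
noncomputable def affSize (φ : AffP) : ℝ :=
  Real.log ((1 + |φ.1.2|) * (1 + φ.1.1) * (1 + φ.1.1⁻¹))

lemma measurable_affSize : Measurable affSize := by
  unfold affSize
  refine Real.measurable_log.comp ?_
  have h1 : Measurable fun φ : AffP => φ.1.1 := by fun_prop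
  have h2 : Measurable fun φ : AffP => φ.1.2 := by fun_prop
  exact ((measurable_const.add h2.norm).mul (measurable_const.add h1)).mul
    (measurable_const.add h1.inv)

lemma exp_affSize (φ : AffP) :
    Real.exp (affSize φ) = (1 + |φ.1.2|) * (1 + φ.1.1) * (1 + φ.1.1⁻¹) := by
  have := φ.2
  exact Real.exp_log (by positivity)

lemma affSize_nonneg (φ : AffP) : 0 ≤ affSize φ := by
  have h := φ.2
  have h' := inv_pos.2 h
  refine Real.log_nonneg ?_
  have h1 : (1 : ℝ) ≤ 1 + |φ.1.2| := by simp
  have h2 : (1 : ℝ) ≤ 1 + φ.1.1 := by linarith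
  have h3 : (1 : ℝ) ≤ 1 + φ.1.1⁻¹ := by linarith
  exact one_le_mul_of_one_le_of_one_le (one_le_mul_of_one_le_of_one_le h1 h2) h3

lemma one_add_abs_le_exp_affSize (φ : AffP) : 1 + |φ.1.2| ≤ Real.exp (affSize φ) := by
  have h := φ.2
  have h' := inv_pos.2 h
  rw [exp_affSize, mul_assoc]
  refine le_mul_of_one_le_right (by positivity) ?_
  exact one_le_mul_of_one_le_of_one_le (by linarith) (by linarith)

lemma abs_log_dilation_le (φ : AffP) : |Real.log φ.1.1| ≤ affSize φ := by
  have h := φ.2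
  have h' := inv_pos.2 h
  have hb := abs_nonneg φ.1.2
  have hinv : φ.1.1 * φ.1.1⁻¹ = 1 := mul_inv_cancel₀ h.ne'
  have key : (1 + φ.1.1) * (1 + φ.1.1⁻¹) ≤ (1 + |φ.1.2|) * (1 + φ.1.1) * (1 + φ.1.1⁻¹) := by
    rw [mul_assoc]
    exact le_mul_of_one_le_left (by positivity) (by linarith)
  rw [abs_le', ← Real.log_inv]
  constructor <;> refine Real.log_le_log (by positivity) (le_trans ?_ key) <;> nlinarith

lemma abs_log_pull_sub_le (φ : AffP) (y : ℝ) :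
    |Real.log (1 + |pull φ y|) - Real.log (1 + |y|)| ≤ affSize φ := by
  have h := φ.2
  have h' := inv_pos.2 h
  have hb := abs_nonneg φ.1.2
  have hy := abs_nonneg y
  have hp := abs_nonneg (pull φ y)
  have h1 : 1 + |pull φ y| ≤ Real.exp (affSize φ) * (1 + |y|) := by
    rw [exp_affSize]
    have e1 : |pull φ y| ≤ (|y| + |φ.1.2|) * φ.1.1⁻¹ := by
      unfold pull
      rw [abs_div, abs_of_pos h, div_eq_mul_inv]
      gcongr
      exact abs_sub _ _
    have e2 : 1 + φ.1.1⁻¹ ≤ (1 + φ.1.1) * (1 + φ.1.1⁻¹) := by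
      nlinarith [mul_pos h h']
    calc 1 + |pull φ y| ≤ 1 + (|y| + |φ.1.2|) * φ.1.1⁻¹ := by linarith
      _ ≤ (1 + |φ.1.2|) * (1 + φ.1.1⁻¹) * (1 + |y|) := by
          nlinarith [mul_nonneg hb hy, mul_nonneg (mul_nonneg hb hy) h'.le, mul_nonneg hy h'.le,
            mul_nonneg hb h'.le]
      _ ≤ (1 + |φ.1.2|) * ((1 + φ.1.1) * (1 + φ.1.1⁻¹)) * (1 + |y|) := by gcongr
      _ = _ := by ring
  have h2 : 1 + |y| ≤ Real.exp (affSize φ) * (1 + |pull φ y|) := by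
    rw [exp_affSize]
    have e1 : |y| ≤ φ.1.1 * |pull φ y| + |φ.1.2| := by
      calc |y| = |φ.1.1 * pull φ y + φ.1.2| := by rw [apply_pull]
        _ ≤ |φ.1.1 * pull φ y| + |φ.1.2| := abs_add_le _ _
        _ = _ := by rw [abs_mul, abs_of_pos h]
    calc 1 + |y| ≤ 1 + (φ.1.1 * |pull φ y| + |φ.1.2|) := by linarith
      _ ≤ (1 + |φ.1.2|) * (1 + φ.1.1) * 1 * (1 + |pull φ y|) := by
          nlinarith [mul_nonneg hb hp, mul_nonneg (mul_nonneg hb hp) h.le, mul_nonneg hp h.le,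
            mul_nonneg hb h.le]
      _ ≤ _ := by gcongr; linarith
  rw [abs_le']
  constructor
  · have := Real.log_le_log (by positivity) h1
    rw [Real.log_mul (Real.exp_pos _).ne' (by positivity), Real.log_exp] at this
    linarith
  · have := Real.log_le_log (by positivity) h2
    rw [Real.log_mul (Real.exp_pos _).ne' (by positivity), Real.log_exp] at this
    linarith

lemma one_add_rpow_le {x ε : ℝ} (hx : 0 ≤ x) (hε : 0 ≤ ε) :
    (1 + x) ^ ε ≤ 2 ^ ε * (1 + x ^ ε) := by
  have h2 : (0 : ℝ) ≤ 2 ^ ε := by positivity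
  rcases le_total x 1 with h | h
  · calc (1 + x) ^ ε ≤ 2 ^ ε := Real.rpow_le_rpow (by positivity) (by linarith) hε
      _ ≤ _ := le_mul_of_one_le_right h2 (by have := Real.rpow_nonneg hx ε; linarith)
  · calc (1 + x) ^ ε ≤ (2 * x) ^ ε := Real.rpow_le_rpow (by positivity) (by linarith) hε
      _ = 2 ^ ε * x ^ ε := Real.mul_rpow (by norm_num) hx
      _ ≤ _ := by gcongr; linarith

lemma mul_mul_le_cubes {a b c : ℝ} (ha : 0 ≤ a) (hb : 0 ≤ b) (hc : 0 ≤ c) :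
    a * b * c ≤ a ^ 3 + b ^ 3 + c ^ 3 := by
  have h : 0 ≤ (a + b + c) * ((a - b) ^ 2 + (b - c) ^ 2 + (a - c) ^ 2) := by positivity
  have : 0 ≤ a ^ 3 + b ^ 3 + c ^ 3 := by positivity
  nlinarith

lemma exists_integrable_exp_affSize {lam : Measure AffP} [IsProbabilityMeasure lam]
    (hmom : ∃ ε : ℝ, 0 < ε ∧
      ∫⁻ φ : AffP, ENNReal.ofReal (φ.1.1 ^ ε + φ.1.1 ^ (-ε) + |φ.1.2| ^ ε) ∂lam < ⊤) :
    ∃ η : ℝ, 0 < η ∧ Integrable (fun φ => Real.exp (η * affSize φ)) lam := by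
  obtain ⟨ε, hε, hfin⟩ := hmom
  have h1 : Measurable fun φ : AffP => φ.1.1 := by fun_prop
  have h2 : Measurable fun φ : AffP => φ.1.2 := by fun_prop
  have hint : Integrable (fun φ : AffP => φ.1.1 ^ ε + φ.1.1 ^ (-ε) + |φ.1.2| ^ ε) lam := by
    refine ⟨?_, ?_⟩
    · exact (((h1.pow_const _).add (h1.pow_const _)).add
        (h2.norm.pow_const _)).aestronglyMeasurable
    · rw [hasFiniteIntegral_iff_ofReal]
      · exact hfin
      · refine ae_of_all _ fun φ => ?_
        have := φ.2
        simp only [Pi.zero_apply]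
        positivity
  refine ⟨ε / 3, by positivity, ?_⟩
  have hint2 : Integrable (fun φ : AffP =>
      2 ^ ε * (3 + (φ.1.1 ^ ε + φ.1.1 ^ (-ε) + |φ.1.2| ^ ε))) lam :=
    ((integrable_const _).add hint).const_mul _
  refine hint2.mono' (Real.measurable_exp.comp
    (measurable_affSize.const_mul _)).aestronglyMeasurable (ae_of_all _ fun φ => ?_)
  have hr := φ.2
  have hr' := inv_pos.2 hr
  have cube : ∀ z : ℝ, 0 ≤ z → (z ^ (ε / 3)) ^ 3 = z ^ ε := by
    intro z hz
    rw [← Real.rpow_natCast, ← Real.rpow_mul hz]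
    norm_num
  rw [Real.norm_of_nonneg (Real.exp_pos _).le, mul_comm, Real.exp_mul, exp_affSize,
    Real.mul_rpow (by positivity) (by positivity), Real.mul_rpow (by positivity) (by positivity)]
  refine (mul_mul_le_cubes (by positivity) (by positivity) (by positivity)).trans ?_
  rw [cube _ (by positivity), cube _ (by positivity), cube _ (by positivity)]
  have e1 := one_add_rpow_le (abs_nonneg φ.1.2) hε.le
  have e2 := one_add_rpow_le hr.le hε.le
  have e3 := one_add_rpow_le hr'.le hε.le
  rw [Real.inv_rpow hr.le, ← Real.rpow_neg hr.le] at e3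
  linarith

lemma exp_le_one_add_add_sq_mul (x : ℝ) : Real.exp x ≤ 1 + x + x ^ 2 * Real.exp |x| := by
  have h := Complex.norm_exp_sub_sum_le_norm_mul_exp (x : ℂ) 2
  simp only [Finset.sum_range_succ, Finset.sum_range_zero, pow_zero, pow_one,
    Nat.factorial, Nat.cast_one, div_one, zero_add, Complex.norm_real, Real.norm_eq_abs,
    sq_abs, mul_one] at h
  have h' : ‖Complex.exp x - (1 + x)‖ = |Real.exp x - (1 + x)| := by
    rw [← Real.norm_eq_abs, ← Complex.norm_real]
    push_cast
    rfl
  rw [h'] at h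
  have := le_abs_self (Real.exp x - (1 + x))
  linarith

lemma sq_le_two_mul_exp {x : ℝ} (hx : 0 ≤ x) : x ^ 2 ≤ 2 * Real.exp x := by
  have := Real.quadratic_le_exp_of_nonneg hx
  linarith

lemma integrable_of_abs_le_affine_of_exp {Ω : Type*} [MeasurableSpace Ω] {μ : Measure Ω}
    [IsFiniteMeasure μ] {l : Ω → ℝ} {η : ℝ} (hη : 0 < η)
    (hl : Measurable l) (hl0 : ∀ ω, 0 ≤ l ω)
    (hint : Integrable (fun ω => Real.exp (η * l ω)) μ) {A B : ℝ} {D : Ω → ℝ}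
    (hD : Measurable D) (hbound : ∀ ω, |D ω| ≤ A * l ω + B) : Integrable D μ := by
  have hlint : Integrable l μ := by
    refine (hint.const_mul η⁻¹).mono' hl.aestronglyMeasurable (ae_of_all _ fun ω => ?_)
    rw [Real.norm_of_nonneg (hl0 ω), inv_mul_eq_div, le_div_iff₀ hη]
    have := Real.add_one_le_exp (η * l ω)
    linarith
  exact ((hlint.const_mul A).add (integrable_const B)).mono' hD.aestronglyMeasurable
    (ae_of_all _ hbound)

/-- Random variables with a uniformly negative mean and uniform exponential tails have small
exponential moments uniformly smaller than one. -/
lemma exists_forall_integral_exp_mul_le {Ω : Type*} [MeasurableSpace Ω] {μ : Measure Ω}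
    [IsProbabilityMeasure μ] {l : Ω → ℝ} {η : ℝ} (hη : 0 < η)
    (hl : Measurable l) (hl0 : ∀ ω, 0 ≤ l ω)
    (hint : Integrable (fun ω => Real.exp (η * l ω)) μ) {A : ℝ} (hA : 0 < A) (B : ℝ)
    {a : ℝ} (ha : 0 < a) :
    ∃ κ₀ : ℝ, 0 < κ₀ ∧ ∀ κ : ℝ, 0 < κ → κ ≤ κ₀ → ∀ D : Ω → ℝ, Measurable D →
      (∀ ω, |D ω| ≤ A * l ω + B) → ∫ ω, D ω ∂μ ≤ -a →
      Integrable (fun ω => Real.exp (κ * D ω)) μ ∧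
        ∫ ω, Real.exp (κ * D ω) ∂μ ≤ 1 - κ * a / 2 := by
  set θ : ℝ := η / (2 * A) with hθ
  have hθ0 : 0 < θ := by positivity
  set G : Ω → ℝ := fun ω => 2 / θ ^ 2 * Real.exp (2 * θ * B) * Real.exp (η * l ω) with hG
  have hGint : Integrable G μ := hint.const_mul _
  have hG0 : ∀ ω, 0 < G ω := fun ω => by positivity
  set I : ℝ := ∫ ω, G ω ∂μ with hI
  have hI0 : 0 ≤ I := integral_nonneg fun ω => (hG0 ω).le
  refine ⟨min θ (a / (2 * (I + 1))), by positivity, fun κ hκ hκ0 D hD hDb hDm => ?_⟩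
  have hκθ : κ ≤ θ := hκ0.trans (min_le_left _ _)
  have hκI : κ * (2 * (I + 1)) ≤ a := by
    rw [← le_div_iff₀ (by positivity)]
    exact hκ0.trans (min_le_right _ _)
  have hDint : Integrable D μ :=
    integrable_of_abs_le_affine_of_exp hη hl hl0 hint hD hDb
  have hpt : ∀ ω, Real.exp (κ * D ω) ≤ 1 + κ * D ω + κ ^ 2 * G ω := by
    intro ω
    refine (exp_le_one_add_add_sq_mul _).trans ?_
    have e1 : |κ * D ω| ≤ θ * |D ω| := by
      rw [abs_mul, abs_of_pos hκ]
      gcongr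
    have e2 : (D ω) ^ 2 ≤ 2 / θ ^ 2 * Real.exp (θ * |D ω|) := by
      have := sq_le_two_mul_exp (x := θ * |D ω|) (by positivity)
      rw [mul_pow, sq_abs] at this
      rw [div_mul_eq_mul_div, le_div_iff₀ (by positivity)]
      linarith
    have e3 : Real.exp (θ * |D ω|) * Real.exp (θ * |D ω|)
        ≤ Real.exp (2 * θ * B) * Real.exp (η * l ω) := by
      rw [← Real.exp_add, ← Real.exp_add]
      refine Real.exp_le_exp.2 ?_
      have h2 : 2 * θ * A = η := by rw [hθ]; field_simp
      have h3 : 2 * θ * |D ω| ≤ 2 * θ * (A * l ω + B) := by gcongr; exact hDb ω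
      have h4 : 2 * θ * (A * l ω + B) = η * l ω + 2 * θ * B := by rw [← h2]; ring
      linarith
    have e4 : (κ * D ω) ^ 2 * Real.exp |κ * D ω| ≤ κ ^ 2 * G ω := by
      calc (κ * D ω) ^ 2 * Real.exp |κ * D ω|
          ≤ (κ * D ω) ^ 2 * Real.exp (θ * |D ω|) := by gcongr
        _ = κ ^ 2 * ((D ω) ^ 2 * Real.exp (θ * |D ω|)) := by ring
        _ ≤ κ ^ 2 * (2 / θ ^ 2 * Real.exp (θ * |D ω|) * Real.exp (θ * |D ω|)) := by gcongr
        _ = κ ^ 2 * (2 / θ ^ 2 * (Real.exp (θ * |D ω|) * Real.exp (θ * |D ω|))) := by ring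
        _ ≤ κ ^ 2 * (2 / θ ^ 2 * (Real.exp (2 * θ * B) * Real.exp (η * l ω))) := by gcongr
        _ = _ := by rw [hG]; ring
    linarith
  have hRint : Integrable (fun ω => 1 + κ * D ω + κ ^ 2 * G ω) μ :=
    ((integrable_const 1).add (hDint.const_mul κ)).add (hGint.const_mul _)
  have hexp : Integrable (fun ω => Real.exp (κ * D ω)) μ :=
    hRint.mono' (Real.measurable_exp.comp (hD.const_mul κ)).aestronglyMeasurable
      (ae_of_all _ fun ω => by rw [Real.norm_of_nonneg (Real.exp_pos _).le]; exact hpt ω)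
  refine ⟨hexp, (integral_mono hexp hRint hpt).trans ?_⟩
  have e : ∫ ω, (1 + κ * D ω + κ ^ 2 * G ω) ∂μ = 1 + κ * ∫ ω, D ω ∂μ + κ ^ 2 * I := by
    have hR' : Integrable (fun ω => 1 + κ * D ω) μ :=
      (integrable_const 1).add (hDint.const_mul κ)
    rw [integral_add hR' (hGint.const_mul _),
      integral_add (integrable_const 1) (hDint.const_mul κ), integral_const_mul,
      integral_const_mul]
    simp [hI]
  rw [e]
  have : κ * ∫ ω, D ω ∂μ ≤ κ * (-a) := by gcongr
  nlinarith

lemma integral_clamp_le_of_measure_Ioi_le {μ ν : Measure ℝ} [IsProbabilityMeasure μ]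
    [IsProbabilityMeasure ν] (hνμ : ∀ u, ν (Set.Ioi u) ≤ μ (Set.Ioi u)) {ψ : ℝ → ℝ}
    (hψ : StrictMono ψ) (hψc : Continuous ψ) (hψs : Function.Surjective ψ) (T : ℝ) (hT : 0 ≤ T) :
    ∫ x, max (-T) (min T (ψ x)) ∂ν ≤ ∫ x, max (-T) (min T (ψ x)) ∂μ := by
  set f : ℝ → ℝ := fun x => max (-T) (min T (ψ x)) + T with hf
  have hfc : Continuous f := by fun_prop
  have hf0 : ∀ x, 0 ≤ f x := fun x => by
    have := le_max_left (-T) (min T (ψ x))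
    simp only [hf]
    linarith
  have hf2 : ∀ x, f x ≤ 2 * T := fun x => by
    have : max (-T) (min T (ψ x)) ≤ T := max_le (by linarith) (min_le_left _ _)
    simp only [hf]
    linarith
  have hint : ∀ m : Measure ℝ, IsProbabilityMeasure m → Integrable f m := fun m _ =>
    (integrable_const (2 * T)).mono' hfc.aestronglyMeasurable
      (ae_of_all _ fun x => by rw [Real.norm_of_nonneg (hf0 x)]; exact hf2 x)
  have hset : ∀ t, 0 < t → ν {x | t < f x} ≤ μ {x | t < f x} := by
    intro t ht
    by_cases htT : 2 * T ≤ t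
    · have : {x | t < f x} = ∅ := by
        ext x
        simp only [Set.mem_ofPred_eq, Set.mem_empty_iff_false, iff_false, not_lt]
        exact (hf2 x).trans htT
      simp [this]
    · obtain ⟨x₀, hx₀⟩ := hψs (t - T)
      have : {x | t < f x} = Set.Ioi x₀ := by
        ext x
        rw [Set.mem_Ioi, ← hψ.lt_iff_lt, hx₀]
        simp only [hf, Set.mem_ofPred_eq]
        rw [← sub_lt_iff_lt_add, lt_max_iff, lt_min_iff]
        push Not at htT
        constructor
        · rintro (h | h)
          · linarith
          · exact h.2
        · exact fun h => Or.inr ⟨by linarith, h⟩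
      rw [this]
      exact hνμ x₀
  have hle : ∫⁻ x, ENNReal.ofReal (f x) ∂ν ≤ ∫⁻ x, ENNReal.ofReal (f x) ∂μ := by
    rw [lintegral_eq_lintegral_meas_lt _ (ae_of_all _ hf0) hfc.aemeasurable,
      lintegral_eq_lintegral_meas_lt _ (ae_of_all _ hf0) hfc.aemeasurable]
    exact setLIntegral_mono' measurableSet_Ioi hset
  rw [← ofReal_integral_eq_lintegral_ofReal (hint ν ‹_›) (ae_of_all _ hf0),
    ← ofReal_integral_eq_lintegral_ofReal (hint μ ‹_›) (ae_of_all _ hf0),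
    ENNReal.ofReal_le_ofReal_iff (integral_nonneg hf0)] at hle
  have hsub : ∀ m : Measure ℝ, IsProbabilityMeasure m →
      ∫ x, f x ∂m = ∫ x, max (-T) (min T (ψ x)) ∂m + T := by
    intro m _
    have hc : Integrable (fun x => max (-T) (min T (ψ x))) m := by
      refine ((hint m ‹_›).sub (integrable_const T)).congr (ae_of_all _ fun x => ?_)
      simp [hf]
    simp only [hf]
    rw [integral_add hc (integrable_const T)]
    simp
  rw [hsub ν ‹_›, hsub μ ‹_›] at hle
  linarith

/-- A strictly convex increasing function with bounded slope. -/
noncomputable def convexRamp (x : ℝ) : ℝ := x + √(1 + x ^ 2) / 2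

lemma continuous_convexRamp : Continuous convexRamp := by
  unfold convexRamp
  fun_prop

lemma abs_sqrt_one_add_sq_sub_le (x y : ℝ) : |√(1 + x ^ 2) - √(1 + y ^ 2)| ≤ |x - y| := by
  have hx : 0 < √(1 + x ^ 2) := by positivity
  have hy : 0 < √(1 + y ^ 2) := by positivity
  have hx2 : √(1 + x ^ 2) ^ 2 = 1 + x ^ 2 := Real.sq_sqrt (by positivity)
  have hy2 : √(1 + y ^ 2) ^ 2 = 1 + y ^ 2 := Real.sq_sqrt (by positivity)
  rw [← sq_le_sq]
  have : 1 + x * y ≤ √(1 + x ^ 2) * √(1 + y ^ 2) := by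
    refine (le_abs_self _).trans (abs_le_of_sq_le_sq ?_ (by positivity))
    rw [mul_pow, hx2, hy2]
    nlinarith [sq_nonneg (x - y)]
  nlinarith

lemma strictMono_convexRamp : StrictMono convexRamp := by
  intro x y hxy
  have h := (abs_le.1 (abs_sqrt_one_add_sq_sub_le x y)).2
  rw [abs_of_neg (by linarith)] at h
  unfold convexRamp
  linarith

lemma abs_convexRamp_sub_le (x y : ℝ) : |convexRamp x - convexRamp y| ≤ 2 * |x - y| := by
  have h := abs_sqrt_one_add_sq_sub_le x y
  have h0 := abs_nonneg (x - y)
  have : convexRamp x - convexRamp y = (x - y) + (√(1 + x ^ 2) - √(1 + y ^ 2)) / 2 := by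
    unfold convexRamp; ring
  rw [this]
  refine (abs_add_le _ _).trans ?_
  rw [abs_div, abs_of_pos (by norm_num : (0 : ℝ) < 2)]
  linarith

lemma surjective_convexRamp : Function.Surjective convexRamp := by
  refine continuous_convexRamp.surjective ?_ ?_
  · refine tendsto_atTop_mono (fun x => ?_) tendsto_id
    unfold convexRamp
    have := Real.sqrt_nonneg (1 + x ^ 2)
    simp only [id]
    linarith
  · have h : Tendsto (fun x : ℝ => x / 2 + 1 / 2) atBot atBot :=
      tendsto_atBot_add_const_right _ _ (tendsto_id.atBot_div_const (by norm_num))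
    refine tendsto_atBot_mono' _ ?_ h
    filter_upwards [eventually_le_atBot (0 : ℝ)] with x hx
    unfold convexRamp
    have : √(1 + x ^ 2) ≤ 1 - x := by
      rw [Real.sqrt_le_left (by linarith)]
      nlinarith
    linarith

/-- The slope of `convexRamp`. -/
noncomputable def rampSlope (x : ℝ) : ℝ := 1 + x / (2 * √(1 + x ^ 2))

lemma continuous_rampSlope : Continuous rampSlope := by
  unfold rampSlope
  refine continuous_const.add (continuous_id.div (by fun_prop) fun x => ?_)
  positivity

lemma rampSlope_mem (x : ℝ) : rampSlope x ∈ Set.Icc (0 : ℝ) 2 := by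
  have hx : 0 < √(1 + x ^ 2) := by positivity
  have habs : |x| ≤ √(1 + x ^ 2) := Real.abs_le_sqrt (by linarith)
  have : |x / (2 * √(1 + x ^ 2))| ≤ 1 := by
    rw [abs_div, abs_of_pos (by positivity : 0 < 2 * √(1 + x ^ 2)), div_le_one (by positivity)]
    linarith
  have := abs_le.1 this
  unfold rampSlope
  constructor <;> linarith

lemma rampSlope_mul_lt {x ξ : ℝ} (hξ : ξ ≠ 0) :
    rampSlope x * ξ < convexRamp (x + ξ) - convexRamp x := by
  unfold rampSlope convexRamp
  have hx : 0 < √(1 + x ^ 2) := by positivity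
  have hx2 : √(1 + x ^ 2) ^ 2 = 1 + x ^ 2 := Real.sq_sqrt (by positivity)
  have hy : 0 < √(1 + (x + ξ) ^ 2) := by positivity
  have hy2 : √(1 + (x + ξ) ^ 2) ^ 2 = 1 + (x + ξ) ^ 2 := Real.sq_sqrt (by positivity)
  have key : 1 + x * (x + ξ) < √(1 + x ^ 2) * √(1 + (x + ξ) ^ 2) := by
    refine lt_of_pow_lt_pow_left₀ 2 (by positivity) ?_
    rw [mul_pow, hx2, hy2]
    have := sq_pos_of_ne_zero hξ
    nlinarith
  have e : x / (2 * √(1 + x ^ 2)) * ξ < (√(1 + (x + ξ) ^ 2) - √(1 + x ^ 2)) / 2 := by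
    rw [div_mul_eq_mul_div, div_lt_div_iff₀ (by positivity) (by norm_num)]
    nlinarith
  linarith

lemma rampSlope_mul_le (x ξ : ℝ) : rampSlope x * ξ ≤ convexRamp (x + ξ) - convexRamp x := by
  rcases eq_or_ne ξ 0 with rfl | h
  · simp
  · exact (rampSlope_mul_lt h).le

lemma abs_clamp_sub_le (T a b : ℝ) :
    |max (-T) (min T a) - max (-T) (min T b)| ≤ |a - b| := by
  have h1 := abs_max_sub_max_le_abs (min T a) (min T b) (-T)
  have h2 := abs_min_sub_min_le_max T a T b
  rw [sub_self, abs_zero, max_eq_right (abs_nonneg _)] at h2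
  rw [max_comm (-T), max_comm (-T)]
  exact h1.trans h2

/-- If adding an independent variable `ξ` of nonnegative mean decreases a law on the line in the
stochastic order, then `ξ` vanishes almost surely. -/
lemma ae_eq_zero_of_measure_Ioi_le {Ω : Type*} [MeasurableSpace Ω] {lam : Measure Ω}
    [IsProbabilityMeasure lam] {μ : Measure ℝ} [IsProbabilityMeasure μ] {ξ : Ω → ℝ}
    (hξ : Measurable ξ) (hξi : Integrable ξ lam) (hmean : 0 ≤ ∫ ω, ξ ω ∂lam)
    (hdom : ∀ u, ∫⁻ ω, μ (Set.Ioi (u - ξ ω)) ∂lam ≤ μ (Set.Ioi u)) :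
    ∀ᵐ ω ∂lam, ξ ω = 0 := by
  have hm : Measurable fun p : ℝ × Ω => p.1 + ξ p.2 := by fun_prop
  set ν : Measure ℝ := (μ.prod lam).map fun p : ℝ × Ω => p.1 + ξ p.2 with hν
  have : IsProbabilityMeasure ν := Measure.isProbabilityMeasure_map hm.aemeasurable
  have hνμ : ∀ u, ν (Set.Ioi u) ≤ μ (Set.Ioi u) := by
    intro u
    rw [hν, Measure.map_apply hm measurableSet_Ioi,
      Measure.prod_apply_symm (hm measurableSet_Ioi)]
    refine le_trans (le_of_eq (lintegral_congr fun ω => ?_)) (hdom u)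
    congr 1
    ext x
    simp [sub_lt_iff_lt_add]
  have hcm := continuous_convexRamp.measurable
  have hclamp : ∀ T : ℝ, 0 ≤ T →
      ∫ p : ℝ × Ω, (max (-T) (min T (convexRamp (p.1 + ξ p.2)))
        - max (-T) (min T (convexRamp p.1))) ∂μ.prod lam ≤ 0 := by
    intro T hT
    have h := integral_clamp_le_of_measure_Ioi_le hνμ strictMono_convexRamp
      continuous_convexRamp surjective_convexRamp T hT
    have hc : Continuous fun x => max (-T) (min T (convexRamp x)) := by
      have := continuous_convexRamp
      fun_prop
    rw [hν, integral_map hm.aemeasurable hc.aestronglyMeasurable] at h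
    have hfst : ∫ x, max (-T) (min T (convexRamp x)) ∂μ
        = ∫ p : ℝ × Ω, max (-T) (min T (convexRamp p.1)) ∂μ.prod lam := by
      rw [integral_fun_fst (μ := μ) (ν := lam) fun x => max (-T) (min T (convexRamp x))]
      simp
    have hbd : ∀ x, |max (-T) (min T (convexRamp x))| ≤ T := fun x =>
      abs_le.2 ⟨le_max_left _ _, max_le (by linarith) (min_le_left _ _)⟩
    rw [integral_sub, ← hfst]
    · linarith
    · exact (integrable_const T).mono' (hc.measurable.comp hm).aestronglyMeasurable
        (ae_of_all _ fun p => hbd _)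
    · exact (integrable_const T).mono' (hc.measurable.comp measurable_fst).aestronglyMeasurable
        (ae_of_all _ fun p => hbd _)
  have hbound : Integrable (fun p : ℝ × Ω => 2 * |ξ p.2|) (μ.prod lam) :=
    ((hξi.comp_snd μ).abs).const_mul 2
  have hdiff : ∀ x e : ℝ, |convexRamp (x + e) - convexRamp x| ≤ 2 * |e| := fun x e => by
    have := abs_convexRamp_sub_le (x + e) x
    rwa [add_sub_cancel_left] at this
  have hΔm : Measurable fun p : ℝ × Ω => convexRamp (p.1 + ξ p.2) - convexRamp p.1 :=
    (hcm.comp hm).sub (hcm.comp measurable_fst)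
  have hΔi : Integrable (fun p : ℝ × Ω => convexRamp (p.1 + ξ p.2) - convexRamp p.1)
      (μ.prod lam) :=
    hbound.mono' hΔm.aestronglyMeasurable (ae_of_all _ fun p => hdiff _ _)
  have hle : ∫ p : ℝ × Ω, (convexRamp (p.1 + ξ p.2) - convexRamp p.1) ∂μ.prod lam ≤ 0 := by
    have htend : Tendsto (fun n : ℕ => ∫ p : ℝ × Ω,
        (max (-(n : ℝ)) (min n (convexRamp (p.1 + ξ p.2)))
          - max (-(n : ℝ)) (min n (convexRamp p.1))) ∂μ.prod lam) atTop
        (𝓝 (∫ p : ℝ × Ω, (convexRamp (p.1 + ξ p.2) - convexRamp p.1) ∂μ.prod lam)) := by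
      refine tendsto_integral_of_dominated_convergence (fun p => 2 * |ξ p.2|) (fun n => ?_)
        hbound (fun n => ae_of_all _ fun p => (abs_clamp_sub_le _ _ _).trans (hdiff _ _))
        (ae_of_all _ fun p => ?_)
      · exact ((measurable_const.max (measurable_const.min (hcm.comp hm))).sub
          (measurable_const.max (measurable_const.min
            (hcm.comp measurable_fst)))).aestronglyMeasurable
      · have hz : ∀ z : ℝ, ∀ᶠ n : ℕ in atTop, max (-(n : ℝ)) (min n z) = z := by
          intro z
          filter_upwards [eventually_ge_atTop ⌈|z|⌉₊] with n hn
          have := abs_le.1 (Nat.ceil_le.1 hn)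
          rw [min_eq_right this.2, max_eq_right this.1]
        refine tendsto_const_nhds.congr' ?_
        filter_upwards [hz (convexRamp (p.1 + ξ p.2)), hz (convexRamp p.1)] with n h1 h2
        rw [h1, h2]
    exact le_of_tendsto' htend fun n => hclamp n n.cast_nonneg
  have hsm := continuous_rampSlope.measurable
  have hsi : Integrable (fun p : ℝ × Ω => rampSlope p.1 * ξ p.2) (μ.prod lam) := by
    refine Integrable.mul_prod (f := rampSlope) ?_ hξi
    exact (integrable_const (2 : ℝ)).mono' hsm.aestronglyMeasurable (ae_of_all _ fun x => by
      rw [Real.norm_of_nonneg (rampSlope_mem x).1]; exact (rampSlope_mem x).2)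
  have hs0 : 0 ≤ ∫ p : ℝ × Ω, rampSlope p.1 * ξ p.2 ∂μ.prod lam := by
    rw [integral_prod_mul]
    exact mul_nonneg (integral_nonneg fun x => (rampSlope_mem x).1) hmean
  have hnn : ∀ p : ℝ × Ω,
      0 ≤ convexRamp (p.1 + ξ p.2) - convexRamp p.1 - rampSlope p.1 * ξ p.2 := fun p =>
    sub_nonneg.2 (rampSlope_mul_le _ _)
  have hzero : ∫ p : ℝ × Ω, (convexRamp (p.1 + ξ p.2) - convexRamp p.1
      - rampSlope p.1 * ξ p.2) ∂μ.prod lam = 0 := by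
    refine le_antisymm ?_ (integral_nonneg hnn)
    rw [integral_sub hΔi hsi]
    linarith
  rw [integral_eq_zero_iff_of_nonneg hnn (hΔi.sub hsi)] at hzero
  obtain ⟨x, hx⟩ := (Measure.ae_ae_of_ae_prod hzero).exists
  filter_upwards [hx] with ω hω
  by_contra hne
  have := rampSlope_mul_lt (x := x) hne
  simp only [Pi.zero_apply] at hω
  linarith

/-- The concentration function of `σ` at scale `exp u`. -/
noncomputable def concentration (σ : Measure ℝ) (u : ℝ) : ℝ :=
  ⨆ y, σ.real (Metric.closedBall y (Real.exp u))

section concentration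

variable (σ : Measure ℝ) [IsProbabilityMeasure σ]

lemma bddAbove_real_closedBall (u : ℝ) :
    BddAbove (Set.range fun y => σ.real (Metric.closedBall y (Real.exp u))) :=
  ⟨1, by rintro _ ⟨y, rfl⟩; exact measureReal_le_one⟩

lemma real_closedBall_le_concentration (y u : ℝ) :
    σ.real (Metric.closedBall y (Real.exp u)) ≤ concentration σ u :=
  le_ciSup (bddAbove_real_closedBall σ u) y

lemma concentration_le_one (u : ℝ) : concentration σ u ≤ 1 :=
  ciSup_le fun _ => measureReal_le_one

lemma concentration_nonneg (u : ℝ) : 0 ≤ concentration σ u :=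
  measureReal_nonneg.trans (real_closedBall_le_concentration σ 0 u)

lemma monotone_concentration : Monotone (concentration σ) := fun u v huv =>
  ciSup_le fun y => (measureReal_mono (Metric.closedBall_subset_closedBall
    (Real.exp_le_exp.2 huv))).trans (real_closedBall_le_concentration σ y v)

lemma tendsto_concentration_atTop : Tendsto (concentration σ) atTop (𝓝 1) := by
  refine tendsto_order.2 ⟨fun c hc => ?_, fun c hc => ?_⟩
  · obtain ⟨R, hR, hRσ⟩ := exists_radius_measure_closedBall_le σ
      (ε := ENNReal.ofReal (1 - c)) (ENNReal.ofReal_pos.2 (by linarith))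
    filter_upwards [eventually_ge_atTop (Real.log R)] with u hu
    have h1 : σ.real (Metric.closedBall 0 R)ᶜ < 1 - c :=
      (ENNReal.lt_ofReal_iff_toReal_lt (measure_ne_top _ _)).1 hRσ
    rw [probReal_compl_eq_one_sub measurableSet_closedBall] at h1
    have h2 : R ≤ Real.exp u := by rwa [← Real.log_le_iff_le_exp hR]
    have h3 := (measureReal_mono (μ := σ) (Metric.closedBall_subset_closedBall h2)).trans
      (real_closedBall_le_concentration σ 0 u)
    linarith
  · exact Eventually.of_forall fun u => (concentration_le_one σ u).trans_lt hc

lemma tendsto_concentration_atBot (hσ : ∀ x, σ {x} = 0) :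
    Tendsto (concentration σ) atBot (𝓝 0) := by
  refine tendsto_order.2 ⟨fun c hc => ?_, fun c hc => ?_⟩
  · exact Eventually.of_forall fun u => hc.trans_le (concentration_nonneg σ u)
  · obtain ⟨s, hs, hsσ⟩ := exists_pos_forall_measure_closedBall_le hσ
      (ε := ENNReal.ofReal (c / 2)) (ENNReal.ofReal_pos.2 (by linarith))
    filter_upwards [eventually_le_atBot (Real.log s)] with u hu
    have h2 : Real.exp u ≤ s := by rwa [← Real.le_log_iff_exp_le hs]
    refine lt_of_le_of_lt (ciSup_le fun y => ?_) (half_lt_self hc)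
    refine ENNReal.toReal_le_of_le_ofReal (by linarith) ?_
    exact (measure_mono (Metric.closedBall_subset_closedBall h2)).trans (hsσ y)

end concentration

lemma measurable_dilation : Measurable fun φ : AffP => φ.1.1 := by fun_prop

lemma measurable_log_dilation : Measurable fun φ : AffP => Real.log φ.1.1 :=
  Real.measurable_log.comp measurable_dilation

lemma measure_closedBall_stationary {lam : Measure AffP} {σ : Measure ℝ}
    (hstat : ∀ A : Set ℝ, MeasurableSet A →
      σ A = ∫⁻ φ : AffP, σ ((fun t => φ.1.1 * t + φ.1.2) ⁻¹' A) ∂lam) (y s : ℝ) :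
    σ (Metric.closedBall y s)
      = ∫⁻ φ : AffP, σ (Metric.closedBall (pull φ y) (s / φ.1.1)) ∂lam := by
  rw [hstat _ measurableSet_closedBall]
  simp_rw [preimage_closedBall]

lemma concentration_le_integral {lam : Measure AffP} [IsProbabilityMeasure lam] {σ : Measure ℝ}
    [IsProbabilityMeasure σ]
    (hstat : ∀ A : Set ℝ, MeasurableSet A →
      σ A = ∫⁻ φ : AffP, σ ((fun t => φ.1.1 * t + φ.1.2) ⁻¹' A) ∂lam) (u : ℝ) :
    concentration σ u ≤ ∫ φ : AffP, concentration σ (u - Real.log φ.1.1) ∂lam := by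
  have hint : Integrable (fun φ : AffP => concentration σ (u - Real.log φ.1.1)) lam :=
    (integrable_const (1 : ℝ)).mono' ((monotone_concentration σ).measurable.comp
      (measurable_const.sub measurable_log_dilation)).aestronglyMeasurable
      (ae_of_all _ fun φ => by
        rw [Real.norm_of_nonneg (concentration_nonneg σ _)]; exact concentration_le_one σ _)
  refine ciSup_le fun y => ?_
  refine ENNReal.toReal_le_of_le_ofReal (integral_nonneg fun φ => concentration_nonneg σ _) ?_
  rw [measure_closedBall_stationary hstat, ofReal_integral_eq_lintegral_ofReal hint
    (ae_of_all _ fun φ => concentration_nonneg σ _)]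
  refine lintegral_mono fun φ => ?_
  rw [ENNReal.le_ofReal_iff_toReal_le (measure_ne_top _ _) (concentration_nonneg σ _)]
  have : Real.exp u / φ.1.1 = Real.exp (u - Real.log φ.1.1) := by
    rw [Real.exp_sub, Real.exp_log φ.2]
  rw [this]
  exact real_closedBall_le_concentration σ _ _

lemma ae_dilation_eq_one_of_integral_log_nonneg {lam : Measure AffP} [IsProbabilityMeasure lam]
    {σ : Measure ℝ} [IsProbabilityMeasure σ]
    (hstat : ∀ A : Set ℝ, MeasurableSet A →
      σ A = ∫⁻ φ : AffP, σ ((fun t => φ.1.1 * t + φ.1.2) ⁻¹' A) ∂lam)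
    (hσ : ∀ x, σ {x} = 0) (hint : Integrable (fun φ : AffP => Real.log φ.1.1) lam)
    (hmean : 0 ≤ ∫ φ : AffP, Real.log φ.1.1 ∂lam) :
    ∀ᵐ φ : AffP ∂lam, Real.log φ.1.1 = 0 := by
  set g := concentration σ with hg
  have hgm : Monotone g := monotone_concentration σ
  set G := hgm.stieltjesFunction with hG
  have hgG : ∀ u, g u ≤ G u := fun u => by
    rw [hG, hgm.stieltjesFunction_eq]; exact hgm.le_rightLim le_rfl
  have hGg : ∀ u v, u < v → G u ≤ g v := fun u v huv => by
    rw [hG, hgm.stieltjesFunction_eq]; exact hgm.rightLim_le huv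
  have hG0 : ∀ u, 0 ≤ G u := fun u => (concentration_nonneg σ u).trans (hgG u)
  have hG1 : ∀ u, G u ≤ 1 := fun u =>
    (hGg u (u + 1) (by linarith)).trans (concentration_le_one σ _)
  have htop : Tendsto G atTop (𝓝 1) :=
    tendsto_of_tendsto_of_tendsto_of_le_of_le (tendsto_concentration_atTop σ)
      tendsto_const_nhds hgG hG1
  have hbot : Tendsto G atBot (𝓝 0) := by
    refine tendsto_of_tendsto_of_tendsto_of_le_of_le (tendsto_concentration_atBot σ hσ)
      ((tendsto_concentration_atBot σ hσ).comp
        (tendsto_atBot_add_const_right _ (1 : ℝ) tendsto_id)) hgG fun u => ?_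
    exact hGg u (u + 1) (by linarith)
  have hprob : IsProbabilityMeasure G.measure := G.isProbabilityMeasure hbot htop
  have hGmeas : ∀ v, Measurable fun φ : AffP => G (v - Real.log φ.1.1) := fun v =>
    G.mono.measurable.comp (measurable_const.sub measurable_log_dilation)
  have hGint : ∀ v, Integrable (fun φ : AffP => G (v - Real.log φ.1.1)) lam := fun v =>
    (integrable_const (1 : ℝ)).mono' (hGmeas v).aestronglyMeasurable
      (ae_of_all _ fun φ => by rw [Real.norm_of_nonneg (hG0 _)]; exact hG1 _)
  have hstep : ∀ u v, u < v → G u ≤ ∫ φ : AffP, G (v - Real.log φ.1.1) ∂lam := by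
    intro u v huv
    refine (hGg u v huv).trans ((concentration_le_integral hstat v).trans ?_)
    exact integral_mono_of_nonneg (ae_of_all _ fun φ => concentration_nonneg σ _) (hGint v)
      (ae_of_all _ fun φ => hgG _)
  have hsub : ∀ u, G u ≤ ∫ φ : AffP, G (u - Real.log φ.1.1) ∂lam := by
    intro u
    have hlim : Tendsto (fun v => ∫ φ : AffP, G (v - Real.log φ.1.1) ∂lam) (𝓝[>] u)
        (𝓝 (∫ φ : AffP, G (u - Real.log φ.1.1) ∂lam)) := by
      refine tendsto_integral_filter_of_dominated_convergence (fun _ => 1)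
        (Eventually.of_forall fun v => (hGmeas v).aestronglyMeasurable)
        (Eventually.of_forall fun v => ae_of_all _ fun φ => by
          rw [Real.norm_of_nonneg (hG0 _)]; exact hG1 _)
        (integrable_const _) (ae_of_all _ fun φ => ?_)
      have hc := (G.right_continuous (u - Real.log φ.1.1)).tendsto
      refine hc.comp (tendsto_nhdsWithin_iff.2 ⟨?_, ?_⟩)
      · exact ((continuous_id.sub continuous_const).tendsto u).mono_left nhdsWithin_le_nhds
      · filter_upwards [self_mem_nhdsWithin] with v hv
        simpa using (le_of_lt hv)
    refine ge_of_tendsto hlim ?_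
    filter_upwards [self_mem_nhdsWithin] with v hv
    exact hstep u v hv
  refine ae_eq_zero_of_measure_Ioi_le (μ := G.measure) measurable_log_dilation hint hmean
    fun u => ?_
  simp_rw [G.measure_Ioi htop]
  have hI : Integrable (fun φ : AffP => 1 - G (u - Real.log φ.1.1)) lam :=
    (integrable_const (1 : ℝ)).sub (hGint u)
  rw [← ofReal_integral_eq_lintegral_ofReal hI
    (ae_of_all _ fun φ => sub_nonneg.2 (hG1 _))]
  refine ENNReal.ofReal_le_ofReal ?_
  rw [integral_sub (integrable_const 1) (hGint u)]
  have := hsub u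
  simp
  linarith

lemma map_prod_eq_of_stationary {lam : Measure AffP} [IsProbabilityMeasure lam]
    {σ : Measure ℝ} [IsProbabilityMeasure σ]
    (hstat : ∀ A : Set ℝ, MeasurableSet A →
      σ A = ∫⁻ φ : AffP, σ ((fun t => φ.1.1 * t + φ.1.2) ⁻¹' A) ∂lam) :
    (lam.prod σ).map (fun p : AffP × ℝ => p.1.1.1 * p.2 + p.1.1.2) = σ := by
  ext A hA
  rw [hstat A hA, Measure.map_apply measurable_affine_apply hA,
    Measure.prod_apply (measurable_affine_apply hA)]
  rfl

/-- A probability measure stationary under random translations forces the translations to be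
trivial. -/
lemma ae_translation_eq_zero_of_dilation_eq_one {lam : Measure AffP} [IsProbabilityMeasure lam]
    {σ : Measure ℝ} [IsProbabilityMeasure σ]
    (hstat : ∀ A : Set ℝ, MeasurableSet A →
      σ A = ∫⁻ φ : AffP, σ ((fun t => φ.1.1 * t + φ.1.2) ⁻¹' A) ∂lam)
    (hone : ∀ᵐ φ : AffP ∂lam, φ.1.1 = 1) : ∀ᵐ φ : AffP ∂lam, φ.1.2 = 0 := by
  have hb : Measurable fun φ : AffP => φ.1.2 := by fun_prop
  have hmul : ∀ θ : ℝ, charFun σ θ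
      = (∫ φ : AffP, Complex.exp (θ * φ.1.2 * Complex.I) ∂lam) * charFun σ θ := by
    intro θ
    conv_lhs => rw [← map_prod_eq_of_stationary hstat]
    rw [charFun_apply_real, charFun_apply_real, integral_map measurable_affine_apply.aemeasurable
      (by fun_prop), ← integral_prod_mul]
    have hone' : ∀ᵐ p : AffP × ℝ ∂lam.prod σ, p.1.1.1 = 1 :=
      Measure.quasiMeasurePreserving_fst.ae hone
    refine integral_congr_ae ?_
    filter_upwards [hone'] with p hp
    rw [← Complex.exp_add, hp]
    congr 1
    push_cast
    ring
  have hne : ∀ᶠ θ in 𝓝 (0 : ℝ), charFun σ θ ≠ 0 := by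
    refine continuous_charFun.continuousAt.eventually_ne ?_
    simp
  obtain ⟨δ, hδ, hball⟩ := Metric.eventually_nhds_iff.1 hne
  have hcos : ∀ θ : ℝ, |θ| < δ → ∀ᵐ φ : AffP ∂lam, Real.cos (θ * φ.1.2) = 1 := by
    intro θ hθ
    have h1 : ∫ φ : AffP, Complex.exp (θ * φ.1.2 * Complex.I) ∂lam = 1 := by
      have h0 := hball (y := θ) (by simpa using hθ)
      exact mul_right_cancel₀ h0 (by rw [← hmul θ, one_mul])
    have hpt : ∀ φ : AffP, (Complex.exp (θ * φ.1.2 * Complex.I)).re = Real.cos (θ * φ.1.2) := by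
      intro φ
      rw [← Complex.ofReal_mul, Complex.exp_ofReal_mul_I_re]
    have hi : Integrable (fun φ : AffP => Complex.exp (θ * φ.1.2 * Complex.I)) lam := by
      refine (integrable_const (1 : ℝ)).mono' ?_ (ae_of_all _ fun φ => ?_)
      · exact (Complex.measurable_exp.comp ((measurable_const.mul
          (Complex.measurable_ofReal.comp hb)).mul_const _)).aestronglyMeasurable
      · rw [← Complex.ofReal_mul, Complex.norm_exp_ofReal_mul_I]
    have h2 : ∫ φ : AffP, Real.cos (θ * φ.1.2) ∂lam = 1 := by
      have := integral_re hi
      rw [h1] at this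
      simpa [hpt] using this
    have hci : Integrable (fun φ : AffP => Real.cos (θ * φ.1.2)) lam := by
      have := hi.re
      simpa [hpt] using this
    have h3 : ∫ φ : AffP, (1 - Real.cos (θ * φ.1.2)) ∂lam = 0 := by
      rw [integral_sub (integrable_const _) hci, h2]
      simp
    rw [integral_eq_zero_iff_of_nonneg (fun φ => sub_nonneg.2 (Real.cos_le_one _))
      ((integrable_const _).sub hci)] at h3
    filter_upwards [h3] with φ hφ
    simp only [Pi.zero_apply] at hφ
    linarith
  have hall : ∀ᵐ φ : AffP ∂lam, ∀ n : ℕ, Real.cos (δ / (n + 2) * φ.1.2) = 1 := by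
    refine ae_all_iff.2 fun n => hcos _ ?_
    rw [abs_of_pos (by positivity)]
    exact div_lt_self hδ (by linarith [n.cast_nonneg (α := ℝ)])
  filter_upwards [hall] with φ hφ
  obtain ⟨n, hn⟩ := exists_nat_gt (δ * |φ.1.2|)
  have hlt : |δ / (n + 2) * φ.1.2| < 2 * Real.pi := by
    rw [abs_mul, abs_of_pos (by positivity), div_mul_eq_mul_div, div_lt_iff₀ (by positivity)]
    nlinarith [Real.pi_gt_three, n.cast_nonneg (α := ℝ)]
  have := (Real.cos_eq_one_iff_of_lt_of_lt (abs_lt.1 hlt).1 (abs_lt.1 hlt).2).1 (hφ n)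
  refine (mul_eq_zero.1 this).resolve_left ?_
  positivity

/-- Existence of a stationary probability measure forces contraction on average. -/
lemma integral_log_dilation_neg {lam : Measure AffP} [IsProbabilityMeasure lam]
    (hnofix : ¬ ∃ t : ℝ, ∀ φ ∈ msupport lam, φ.1.1 * t + φ.1.2 = t)
    {σ : Measure ℝ} [IsProbabilityMeasure σ]
    (hstat : ∀ A : Set ℝ, MeasurableSet A →
      σ A = ∫⁻ φ : AffP, σ ((fun t => φ.1.1 * t + φ.1.2) ⁻¹' A) ∂lam)
    (hint : Integrable (fun φ : AffP => Real.log φ.1.1) lam) :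
    ∫ φ : AffP, Real.log φ.1.1 ∂lam < 0 := by
  by_contra! hmean
  have hlog := ae_dilation_eq_one_of_integral_log_nonneg hstat
    (measure_singleton_eq_zero_of_stationary hnofix hstat) hint hmean
  have hone : ∀ᵐ φ : AffP ∂lam, φ.1.1 = 1 := by
    filter_upwards [hlog] with φ hφ
    exact Real.eq_one_of_pos_of_log_eq_zero φ.2 hφ
  refine not_ae_fixed hnofix 0 ?_
  filter_upwards [ae_translation_eq_zero_of_dilation_eq_one hstat hone] with φ hφ
  simp [hφ]

lemma lintegral_iterLaw_succ (lam : Measure AffP) [IsProbabilityMeasure lam] (n : ℕ)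
    {f : ℝ → ENNReal} (hf : Measurable f) :
    ∫⁻ x, f x ∂iterLaw lam (n + 1)
      = ∫⁻ φ : AffP, ∫⁻ x, f (φ.1.1 * x + φ.1.2) ∂iterLaw lam n ∂lam := by
  have := iterLaw_isProbabilityMeasure lam n
  rw [iterLaw, lintegral_map hf measurable_affine_apply]
  exact lintegral_prod _ (hf.comp measurable_affine_apply).aemeasurable

lemma one_add_abs_affine_rpow_le (φ : AffP) (x : ℝ) {κ : ℝ} (hκ : 0 < κ) (hκ1 : κ ≤ 1) :
    (1 + |φ.1.1 * x + φ.1.2|) ^ κ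
      ≤ φ.1.1 ^ κ * (1 + |x|) ^ κ + (1 + |φ.1.2|) ^ κ := by
  have hr := φ.2
  have hx := abs_nonneg x
  have hb := abs_nonneg φ.1.2
  have h1 : |φ.1.1 * x + φ.1.2| ≤ φ.1.1 * |x| + |φ.1.2| := by
    refine (abs_add_le _ _).trans ?_
    rw [abs_mul, abs_of_pos hr]
  calc (1 + |φ.1.1 * x + φ.1.2|) ^ κ
      ≤ (φ.1.1 * (1 + |x|) + (1 + |φ.1.2|)) ^ κ :=
        Real.rpow_le_rpow (by positivity) (by linarith) hκ.le
    _ ≤ (φ.1.1 * (1 + |x|)) ^ κ + (1 + |φ.1.2|) ^ κ :=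
        Real.rpow_add_le_add_rpow (by positivity) (by positivity) hκ.le hκ1
    _ = _ := by rw [Real.mul_rpow hr.le (by positivity)]

/-- Uniform bound for small moments of the iterated laws under contraction on average. -/
lemma lintegral_one_add_abs_rpow_iterLaw_le {lam : Measure AffP} [IsProbabilityMeasure lam]
    {κ m β : ℝ} (hκ : 0 < κ) (hκ1 : κ ≤ 1) (hm0 : 0 ≤ m) (hm1 : m < 1) (hβ : 1 ≤ β)
    (hm : ∫⁻ φ : AffP, ENNReal.ofReal (φ.1.1 ^ κ) ∂lam ≤ ENNReal.ofReal m)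
    (hb : ∫⁻ φ : AffP, ENNReal.ofReal ((1 + |φ.1.2|) ^ κ) ∂lam ≤ ENNReal.ofReal β) (n : ℕ) :
    ∫⁻ x, ENNReal.ofReal ((1 + |x|) ^ κ) ∂iterLaw lam n ≤ ENNReal.ofReal (β / (1 - m)) := by
  have h1m : 0 < 1 - m := by linarith
  have hmeas : Measurable fun x : ℝ => ENNReal.ofReal ((1 + |x|) ^ κ) := by fun_prop
  have hmr : Measurable fun φ : AffP => ENNReal.ofReal (φ.1.1 ^ κ) := by fun_prop
  have hmb : Measurable fun φ : AffP => ENNReal.ofReal ((1 + |φ.1.2|) ^ κ) := by fun_prop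
  induction n with
  | zero =>
    rw [iterLaw, lintegral_dirac' _ hmeas]
    refine ENNReal.ofReal_le_ofReal ?_
    rw [le_div_iff₀ h1m]
    simp
    linarith
  | succ n ih =>
    have := iterLaw_isProbabilityMeasure lam n
    rw [lintegral_iterLaw_succ lam n hmeas]
    calc ∫⁻ φ : AffP, ∫⁻ x, ENNReal.ofReal ((1 + |φ.1.1 * x + φ.1.2|) ^ κ)
            ∂iterLaw lam n ∂lam
        ≤ ∫⁻ φ : AffP, (ENNReal.ofReal (φ.1.1 ^ κ) * ENNReal.ofReal (β / (1 - m))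
            + ENNReal.ofReal ((1 + |φ.1.2|) ^ κ)) ∂lam := by
          refine lintegral_mono fun φ => ?_
          have hr := φ.2
          calc ∫⁻ x, ENNReal.ofReal ((1 + |φ.1.1 * x + φ.1.2|) ^ κ) ∂iterLaw lam n
              ≤ ∫⁻ x, (ENNReal.ofReal (φ.1.1 ^ κ) * ENNReal.ofReal ((1 + |x|) ^ κ)
                  + ENNReal.ofReal ((1 + |φ.1.2|) ^ κ)) ∂iterLaw lam n := by
                refine lintegral_mono fun x => ?_
                rw [← ENNReal.ofReal_mul (by positivity),
                  ← ENNReal.ofReal_add (by positivity) (by positivity)]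
                exact ENNReal.ofReal_le_ofReal (one_add_abs_affine_rpow_le φ x hκ hκ1)
            _ ≤ _ := by
                rw [lintegral_add_right _ measurable_const, lintegral_const_mul _ hmeas,
                  lintegral_const, measure_univ, mul_one]
                gcongr
      _ ≤ ENNReal.ofReal m * ENNReal.ofReal (β / (1 - m)) + ENNReal.ofReal β := by
          rw [lintegral_add_right _ hmb, lintegral_mul_const _ hmr]
          gcongr
      _ = ENNReal.ofReal (β / (1 - m)) := by
          rw [← ENNReal.ofReal_mul hm0, ← ENNReal.ofReal_add (by positivity) (by positivity)]
          congr 1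
          field_simp
          ring

lemma tendsto_log_pull_sub (φ : AffP) :
    Tendsto (fun y => Real.log (1 + |pull φ y|) - Real.log (1 + |y|))
      (comap (fun y : ℝ => |y|) atTop) (𝓝 (-Real.log φ.1.1)) := by
  have hr := φ.2
  have hb := abs_nonneg φ.1.2
  have hid : Tendsto (fun y : ℝ => 1 + |y|) (comap (fun y : ℝ => |y|) atTop) atTop :=
    tendsto_atTop_add_const_left _ _ tendsto_comap
  have h0 : Tendsto (fun y : ℝ => (φ.1.1 + |φ.1.2| + 1) / (1 + |y|))
      (comap (fun y : ℝ => |y|) atTop) (𝓝 0) := hid.const_div_atTop _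
  have h1 : Tendsto (fun y : ℝ => (φ.1.1 + |y - φ.1.2|) / (1 + |y|))
      (comap (fun y : ℝ => |y|) atTop) (𝓝 1) := by
    rw [tendsto_iff_norm_sub_tendsto_zero]
    refine squeeze_zero (fun _ => norm_nonneg _) (fun y => ?_) h0
    have hy := abs_nonneg y
    rw [div_sub_one (by positivity), Real.norm_eq_abs, abs_div, abs_of_pos (by positivity :
      0 < 1 + |y|)]
    gcongr
    have e1 := abs_sub_abs_le_abs_sub y φ.1.2
    have e2 : |y - φ.1.2| ≤ |y| + |φ.1.2| := abs_sub y φ.1.2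
    rw [abs_le]
    constructor <;> linarith
  have h2 := ((Real.continuousAt_log one_ne_zero).tendsto.comp h1).sub_const (Real.log φ.1.1)
  rw [Real.log_one, zero_sub] at h2
  refine h2.congr fun y => ?_
  have hy := abs_nonneg y
  have e : 1 + |pull φ y| = (φ.1.1 + |y - φ.1.2|) / φ.1.1 := by
    unfold pull
    rw [abs_div, abs_of_pos hr]
    field_simp
  rw [e, Function.comp_apply, Real.log_div (by positivity) (by positivity),
    Real.log_div (by positivity) (by positivity)]
  ring

lemma measurable_log_one_add_abs : Measurable fun y : ℝ => Real.log (1 + |y|) := by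
  fun_prop

lemma exists_radius_forall_le_integral_log_pull_sub {lam : Measure AffP}
    [IsProbabilityMeasure lam] (hl : Integrable affSize lam) {a : ℝ}
    (ha : a < -∫ φ : AffP, Real.log φ.1.1 ∂lam) :
    ∃ R : ℝ, 0 < R ∧ ∀ y : ℝ, R < |y| →
      a ≤ ∫ φ : AffP, (Real.log (1 + |pull φ y|) - Real.log (1 + |y|)) ∂lam := by
  have h : Tendsto
      (fun y => ∫ φ : AffP, (Real.log (1 + |pull φ y|) - Real.log (1 + |y|)) ∂lam)
      (comap (fun y : ℝ => |y|) atTop) (𝓝 (∫ φ : AffP, -Real.log φ.1.1 ∂lam)) := by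
    refine tendsto_integral_filter_of_dominated_convergence affSize
      (Eventually.of_forall fun y => ?_)
      (Eventually.of_forall fun y => ae_of_all _ fun φ => abs_log_pull_sub_le φ y)
      hl (ae_of_all _ tendsto_log_pull_sub)
    exact ((measurable_log_one_add_abs.comp (measurable_pull_left y)).sub
      measurable_const).aestronglyMeasurable
  rw [integral_neg] at h
  have h2 := h.eventually (lt_mem_nhds ha)
  rw [eventually_comap] at h2
  obtain ⟨R, hR⟩ := (h2.and (eventually_gt_atTop 0)).exists_forall_of_atTop
  refine ⟨R, (hR R le_rfl).2, fun y hy => ((hR |y| hy.le).1 y rfl).le⟩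

/-- The probability that the backward walk started at `y` lies in `[-R, R]` at time `k`. -/
noncomputable def visitProb (lam : Measure AffP) (R : ℝ) : ℕ → ℝ → ENNReal
  | 0 => (Metric.closedBall 0 R).indicator 1
  | k + 1 => fun y => ∫⁻ φ : AffP, visitProb lam R k (pull φ y) ∂lam

lemma measurable_visitProb (lam : Measure AffP) [IsProbabilityMeasure lam] (R : ℝ) (k : ℕ) :
    Measurable (visitProb lam R k) := by
  induction k with
  | zero => exact measurable_one.indicator measurableSet_closedBall
  | succ k ih => exact Measurable.lintegral_prod_right' (ih.comp measurable_pull)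

lemma visitProb_le_one (lam : Measure AffP) [IsProbabilityMeasure lam] (R : ℝ) (k : ℕ) (y : ℝ) :
    visitProb lam R k y ≤ 1 := by
  induction k generalizing y with
  | zero => exact Set.indicator_le_self' (fun _ _ => zero_le) y
  | succ k ih =>
    refine (lintegral_mono fun φ => ih (pull φ y)).trans ?_
    simp

lemma visitProb_le {lam : Measure AffP} [IsProbabilityMeasure lam]
    {σ : Measure ℝ} [IsProbabilityMeasure σ]
    (hstat : ∀ A : Set ℝ, MeasurableSet A →
      σ A = ∫⁻ φ : AffP, σ ((fun t => φ.1.1 * t + φ.1.2) ⁻¹' A) ∂lam)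
    {κ m R R' : ℝ} (hκ : 0 < κ) (hm0 : 0 ≤ m)
    (hm : ∫⁻ φ : AffP, ENNReal.ofReal (φ.1.1 ^ κ) ∂lam ≤ ENNReal.ofReal m)
    (hR : 0 < R) (hR' : 0 < R') (hσ : 1 ≤ 2 * σ (Metric.closedBall 0 R'))
    (k : ℕ) (y s : ℝ) (hs : 0 < s) :
    visitProb lam R k y
      ≤ 2 * σ (Metric.closedBall y s) + ENNReal.ofReal (((R + R') / s) ^ κ * m ^ k) := by
  induction k generalizing y s with
  | zero =>
    by_cases hy : y ∈ Metric.closedBall (0 : ℝ) R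
    · rcases le_total (R + R') s with h | h
      · refine (visitProb_le_one lam R 0 y).trans (hσ.trans (le_add_right ?_))
        gcongr
        intro t ht
        simp only [Metric.mem_closedBall, Real.dist_eq, sub_zero] at hy ht ⊢
        have : |t - y| ≤ |t| + |y| := abs_sub t y
        linarith
      · refine (visitProb_le_one lam R 0 y).trans (le_add_left ?_)
        rw [pow_zero, mul_one, ENNReal.one_le_ofReal]
        exact Real.one_le_rpow ((one_le_div hs).2 h) hκ.le
    · have : visitProb lam R 0 y = 0 := Set.indicator_of_notMem hy _
      rw [this]
      exact zero_le
  | succ k ih =>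
    have hmr : Measurable fun φ : AffP => ENNReal.ofReal (φ.1.1 ^ κ) := by fun_prop
    calc visitProb lam R (k + 1) y
        = ∫⁻ φ : AffP, visitProb lam R k (pull φ y) ∂lam := rfl
      _ ≤ ∫⁻ φ : AffP, (2 * σ (Metric.closedBall (pull φ y) (s / φ.1.1))
            + ENNReal.ofReal (((R + R') / s) ^ κ * m ^ k) * ENNReal.ofReal (φ.1.1 ^ κ)) ∂lam := by
          refine lintegral_mono fun φ => (ih _ _ (div_pos hs φ.2)).trans_eq ?_
          have hr := φ.2
          congr 1
          rw [← ENNReal.ofReal_mul (by positivity)]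
          congr 1
          have : (R + R') / (s / φ.1.1) = (R + R') / s * φ.1.1 := by field_simp
          rw [this, Real.mul_rpow (by positivity) hr.le]
          ring
      _ ≤ 2 * σ (Metric.closedBall y s)
            + ENNReal.ofReal (((R + R') / s) ^ κ * m ^ k) * ENNReal.ofReal m := by
          rw [lintegral_add_right _ (hmr.const_mul _), lintegral_const_mul _ hmr,
            lintegral_const_mul' _ _ (by simp), ← measure_closedBall_stationary hstat]
          gcongr
      _ = _ := by
          rw [← ENNReal.ofReal_mul (by positivity), mul_assoc, pow_succ]

/-- The backward walk leaves every bounded set in probability, uniformly in its starting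
point. -/
lemma exists_forall_visitProb_le {lam : Measure AffP} [IsProbabilityMeasure lam]
    {σ : Measure ℝ} [IsProbabilityMeasure σ]
    (hstat : ∀ A : Set ℝ, MeasurableSet A →
      σ A = ∫⁻ φ : AffP, σ ((fun t => φ.1.1 * t + φ.1.2) ⁻¹' A) ∂lam)
    (hσ : ∀ x, σ {x} = 0)
    {κ m R : ℝ} (hκ : 0 < κ) (hm0 : 0 ≤ m) (hm1 : m < 1)
    (hm : ∫⁻ φ : AffP, ENNReal.ofReal (φ.1.1 ^ κ) ∂lam ≤ ENNReal.ofReal m)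
    (hR : 0 < R) {ε : ℝ} (hε : 0 < ε) :
    ∃ k : ℕ, ∀ y, visitProb lam R k y ≤ ENNReal.ofReal ε := by
  obtain ⟨R', hR', hlt⟩ := exists_radius_measure_closedBall_le σ
    (ε := 2⁻¹) (by simp)
  have hhalf : 1 ≤ 2 * σ (Metric.closedBall 0 R') := by
    have h1 := prob_add_prob_compl (μ := σ) (measurableSet_closedBall (x := (0 : ℝ)) (ε := R'))
    have h2 : (2⁻¹ : ENNReal) ≤ σ (Metric.closedBall 0 R') := by
      by_contra! hcon
      have := ENNReal.add_lt_add hcon hlt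
      rw [h1, ENNReal.inv_two_add_inv_two] at this
      exact lt_irrefl _ this
    calc (1 : ENNReal) = 2 * 2⁻¹ := (ENNReal.mul_inv_cancel (by simp) (by simp)).symm
      _ ≤ _ := by gcongr
  obtain ⟨s, hs, hball⟩ := exists_pos_forall_measure_closedBall_le hσ
    (ε := ENNReal.ofReal (ε / 4)) (by simpa using hε)
  have hlim : Tendsto (fun k : ℕ => ((R + R') / s) ^ κ * m ^ k) atTop (𝓝 0) := by
    simpa using (tendsto_pow_atTop_nhds_zero_of_lt_one hm0 hm1).const_mul (((R + R') / s) ^ κ)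
  obtain ⟨k, hk⟩ := (hlim.eventually (gt_mem_nhds (half_pos hε))).exists
  refine ⟨k, fun y => (visitProb_le hstat hκ hm0 hm hR hR' hhalf k y s hs).trans ?_⟩
  calc 2 * σ (Metric.closedBall y s) + ENNReal.ofReal (((R + R') / s) ^ κ * m ^ k)
      ≤ ENNReal.ofReal 2 * ENNReal.ofReal (ε / 4) + ENNReal.ofReal (ε / 2) := by
        rw [ENNReal.ofReal_ofNat]
        gcongr
        exact hball y
    _ = ENNReal.ofReal ε := by
        rw [← ENNReal.ofReal_mul (by norm_num), ← ENNReal.ofReal_add (by positivity)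
          (by positivity)]
        congr 1
        ring

lemma integral_toReal_visitProb_pull (lam : Measure AffP) [IsProbabilityMeasure lam] (R : ℝ)
    (k : ℕ) (y : ℝ) :
    ∫ φ : AffP, (visitProb lam R k (pull φ y)).toReal ∂lam
      = (visitProb lam R (k + 1) y).toReal :=
  integral_toReal ((measurable_visitProb lam R k).comp (measurable_pull_left y)).aemeasurable
    (ae_of_all _ fun _ => (visitProb_le_one lam R k _).trans_lt ENNReal.one_lt_top)

lemma toReal_visitProb_le_one (lam : Measure AffP) [IsProbabilityMeasure lam] (R : ℝ)
    (k : ℕ) (y : ℝ) : (visitProb lam R k y).toReal ≤ 1 :=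
  ENNReal.toReal_le_of_le_ofReal zero_le_one (by simpa using visitProb_le_one lam R k y)

lemma integrable_toReal_visitProb_pull (lam : Measure AffP) [IsProbabilityMeasure lam] (R : ℝ)
    (k : ℕ) (y : ℝ) :
    Integrable (fun φ : AffP => (visitProb lam R k (pull φ y)).toReal) lam := by
  refine (integrable_const (1 : ℝ)).mono' ((measurable_visitProb lam R k).comp
    (measurable_pull_left y)).ennreal_toReal.aestronglyMeasurable (ae_of_all _ fun φ => ?_)
  rw [Real.norm_of_nonneg ENNReal.toReal_nonneg]
  exact toReal_visitProb_le_one lam R k _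

lemma integrable_log_pull_sub {lam : Measure AffP} (hl : Integrable affSize lam)
    (y : ℝ) : Integrable
      (fun φ : AffP => Real.log (1 + |pull φ y|) - Real.log (1 + |y|)) lam :=
  hl.mono' ((measurable_log_one_add_abs.comp (measurable_pull_left y)).sub
    measurable_const).aestronglyMeasurable (ae_of_all _ fun φ => abs_log_pull_sub_le φ y)

/-- A bounded perturbation of `log (1 + |y|)` has uniformly positive drift along the backward
walk. -/
lemma exists_bounded_correction_of_drift {lam : Measure AffP} [IsProbabilityMeasure lam]
    (hl : Integrable affSize lam) {a R : ℝ} (ha : 0 < a)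
    (hdrift : ∀ y : ℝ, R < |y| →
      a ≤ ∫ φ : AffP, (Real.log (1 + |pull φ y|) - Real.log (1 + |y|)) ∂lam)
    (hvisit : ∀ ε : ℝ, 0 < ε → ∃ k : ℕ, ∀ y, visitProb lam R k y ≤ ENNReal.ofReal ε) :
    ∃ B : ℝ, 0 ≤ B ∧ ∃ h : ℝ → ℝ, Measurable h ∧ (∀ y, -B ≤ h y ∧ h y ≤ 0) ∧
      ∀ y, a / 2 ≤ ∫ φ : AffP, ((Real.log (1 + |pull φ y|) - Real.log (1 + |y|))
        + (h (pull φ y) - h y)) ∂lam := by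
  set M : ℝ := ∫ φ, affSize φ ∂lam with hM
  have hM0 : 0 ≤ M := integral_nonneg affSize_nonneg
  have hMa : 0 < M + a := by linarith
  obtain ⟨k₀, hk₀⟩ := hvisit (a / 2 / (M + a)) (by positivity)
  set q : ℕ → ℝ → ℝ := fun k y => (visitProb lam R k y).toReal with hq
  have hq0 : ∀ k y, 0 ≤ q k y := fun k y => ENNReal.toReal_nonneg
  have hq1 : ∀ k y, q k y ≤ 1 := fun k y => toReal_visitProb_le_one lam R k y
  refine ⟨(M + a) * k₀, by positivity, fun y => -(M + a) * ∑ k ∈ Finset.range k₀, q k y,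
    ?_, fun y => ⟨?_, ?_⟩, fun y => ?_⟩
  · exact (Finset.measurable_sum _ fun k _ =>
      (measurable_visitProb lam R k).ennreal_toReal).const_mul _
  · have : ∑ k ∈ Finset.range k₀, q k y ≤ k₀ := by
      simpa using Finset.sum_le_card_nsmul (Finset.range k₀) (fun k => q k y) 1
        fun k _ => hq1 k y
    nlinarith
  · have : 0 ≤ ∑ k ∈ Finset.range k₀, q k y := Finset.sum_nonneg fun k _ => hq0 k y
    nlinarith
  · have hqint : ∀ k, Integrable (fun φ : AffP => q k (pull φ y)) lam := fun k =>
      integrable_toReal_visitProb_pull lam R k y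
    have hsum : Integrable (fun φ : AffP => ∑ k ∈ Finset.range k₀, q k (pull φ y)) lam :=
      integrable_finsetSum _ fun k _ => hqint k
    have hcorr : ∫ φ : AffP, (-(M + a) * ∑ k ∈ Finset.range k₀, q k (pull φ y)
        - -(M + a) * ∑ k ∈ Finset.range k₀, q k y) ∂lam = (M + a) * (q 0 y - q k₀ y) := by
      rw [integral_sub (hsum.const_mul _) (integrable_const _), integral_const_mul,
        integral_finsetSum _ fun k _ => hqint k, integral_const]
      have : ∀ k, ∫ φ : AffP, q k (pull φ y) ∂lam = q (k + 1) y := fun k =>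
        integral_toReal_visitProb_pull lam R k y
      simp_rw [this]
      have htel := Finset.sum_range_sub (fun k => q k y) k₀
      rw [Finset.sum_sub_distrib] at htel
      simp only [probReal_univ, one_smul]
      linear_combination (-(M + a)) * htel
    have hI : Integrable (fun φ : AffP => -(M + a) * ∑ k ∈ Finset.range k₀, q k (pull φ y)
        - -(M + a) * ∑ k ∈ Finset.range k₀, q k y) lam :=
      (hsum.const_mul _).sub (integrable_const _)
    beta_reduce
    rw [integral_add (integrable_log_pull_sub hl y) hI, hcorr]
    have hqk : (M + a) * q k₀ y ≤ a / 2 := by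
      have : q k₀ y ≤ a / 2 / (M + a) :=
        ENNReal.toReal_le_of_le_ofReal (by positivity) (hk₀ y)
      rwa [le_div_iff₀ hMa, mul_comm] at this
    have hlow : -M ≤ ∫ φ : AffP, (Real.log (1 + |pull φ y|) - Real.log (1 + |y|)) ∂lam := by
      rw [hM, ← integral_neg]
      exact integral_mono hl.neg (integrable_log_pull_sub hl y) fun φ =>
        (abs_le.1 (abs_log_pull_sub_le φ y)).1
    by_cases hy : R < |y|
    · have h1 := hdrift y hy
      have h2 := mul_nonneg hMa.le (hq0 0 y)
      linarith
    · have : q 0 y = 1 := by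
        have : visitProb lam R 0 y = 1 :=
          Set.indicator_of_mem (by simpa using not_lt.1 hy) _
        simp [hq, this]
      rw [this]
      linarith

lemma lintegral_ofReal_mul_le {Ω : Type*} [MeasurableSpace Ω] {μ : Measure Ω} {f g : Ω → ℝ}
    (hf : Integrable f μ) (hf0 : ∀ ω, 0 ≤ f ω) {c v : ℝ} (hv : 0 ≤ v) (hc : ∫ ω, f ω ∂μ ≤ c)
    (hgf : ∀ ω, g ω ≤ f ω * v) :
    ∫⁻ ω, ENNReal.ofReal (g ω) ∂μ ≤ ENNReal.ofReal (c * v) := by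
  calc ∫⁻ ω, ENNReal.ofReal (g ω) ∂μ ≤ ∫⁻ ω, ENNReal.ofReal (f ω * v) ∂μ :=
        lintegral_mono fun ω => ENNReal.ofReal_le_ofReal (hgf ω)
    _ = ENNReal.ofReal (∫ ω, f ω * v ∂μ) :=
        (ofReal_integral_eq_lintegral_ofReal (hf.mul_const v)
          (ae_of_all _ fun ω => mul_nonneg (hf0 ω) hv)).symm
    _ ≤ _ := by
        rw [integral_mul_const]
        gcongr

/-- Existence of a Lyapunov function `V`, comparable with `(1 + |y|) ^ (-κ)`, for the backward
walk. -/
lemma exists_lyapunov {lam : Measure AffP} [IsProbabilityMeasure lam]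
    (hmom : ∃ ε : ℝ, 0 < ε ∧
      ∫⁻ φ : AffP, ENNReal.ofReal (φ.1.1 ^ ε + φ.1.1 ^ (-ε) + |φ.1.2| ^ ε) ∂lam < ⊤)
    (hnofix : ¬ ∃ t : ℝ, ∀ φ ∈ msupport lam, φ.1.1 * t + φ.1.2 = t)
    {σ : Measure ℝ} [IsProbabilityMeasure σ]
    (hstat : ∀ A : Set ℝ, MeasurableSet A →
      σ A = ∫⁻ φ : AffP, σ ((fun t => φ.1.1 * t + φ.1.2) ⁻¹' A) ∂lam) :
    ∃ κ : ℝ, 0 < κ ∧ κ ≤ 1 ∧ ∃ q : ℝ, 0 < q ∧ q < 1 ∧ ∃ K : ℝ, 1 ≤ K ∧ ∃ V : ℝ → ℝ, Measurable V ∧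
      (∀ y, (1 + |y|) ^ (-κ) ≤ V y) ∧ (∀ y, V y ≤ K) ∧
      (∀ y, ∫⁻ φ : AffP, ENNReal.ofReal (V (pull φ y)) ∂lam ≤ ENNReal.ofReal (q * V y)) ∧
      (∀ y, ∫⁻ φ : AffP, ENNReal.ofReal (φ.1.1 ^ (-(κ / 8)) * V (pull φ y)) ∂lam
        ≤ ENNReal.ofReal (q * V y)) ∧
      (∀ y, ∫⁻ φ : AffP, ENNReal.ofReal (φ.1.1 ^ (-κ) * V (pull φ y)) ∂lam
        ≤ ENNReal.ofReal (K * V y)) ∧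
      ∀ n, ∫⁻ x, ENNReal.ofReal ((1 + |x|) ^ κ) ∂iterLaw lam n ≤ ENNReal.ofReal K := by
  obtain ⟨η, hη, hexp⟩ := exists_integrable_exp_affSize hmom
  have hl : Integrable affSize lam :=
    integrable_of_abs_le_affine_of_exp (A := 1) (B := 0) hη measurable_affSize affSize_nonneg
      hexp measurable_affSize fun φ => by rw [abs_of_nonneg (affSize_nonneg φ)]; simp
  have hlog : Integrable (fun φ : AffP => Real.log φ.1.1) lam :=
    hl.mono' measurable_log_dilation.aestronglyMeasurable (ae_of_all _ abs_log_dilation_le)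
  have hσ := measure_singleton_eq_zero_of_stationary hnofix hstat
  have hneg := integral_log_dilation_neg hnofix hstat hlog
  set a : ℝ := -(∫ φ : AffP, Real.log φ.1.1 ∂lam) / 2 with ha_def
  have ha : 0 < a := by linarith
  have hmean : ∫ φ : AffP, Real.log φ.1.1 ∂lam = -(2 * a) := by linarith
  have hdil : ∀ (φ : AffP) (t : ℝ), Real.exp (t * Real.log φ.1.1) = φ.1.1 ^ t := fun φ t => by
    rw [Real.rpow_def_of_pos φ.2, mul_comm]
  obtain ⟨R, hR, hdrift⟩ := exists_radius_forall_le_integral_log_pull_sub hl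
    (show a < -∫ φ : AffP, Real.log φ.1.1 ∂lam by linarith)
  obtain ⟨B, hB, h, hmeas, hbd, hLdrift⟩ := exists_bounded_correction_of_drift hl ha hdrift
    fun ε hε => by
      obtain ⟨κ₁, hκ₁, hκ⟩ := exists_forall_integral_exp_mul_le hη measurable_affSize
        affSize_nonneg hexp one_pos 0 ha
      obtain ⟨hi, hle⟩ := hκ κ₁ hκ₁ le_rfl (fun φ => Real.log φ.1.1) measurable_log_dilation
        (fun φ => by simpa using abs_log_dilation_le φ) (by linarith)
      have hm0 : 0 ≤ 1 - κ₁ * a / 2 := (integral_nonneg fun φ => (Real.exp_pos _).le).trans hle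
      refine exists_forall_visitProb_le hstat hσ hκ₁ hm0
        (by have := mul_pos hκ₁ ha; linarith) ?_ hR hε
      simpa using lintegral_ofReal_mul_le hi (fun φ => (Real.exp_pos _).le) zero_le_one hle
        fun φ => by rw [hdil, mul_one]
  obtain ⟨κ₀, hκ₀, hκ⟩ := exists_forall_integral_exp_mul_le hη measurable_affSize
    affSize_nonneg hexp two_pos B (a := a / 4) (by positivity)
  set κ : ℝ := min κ₀ (min 1 (η / 2)) with hκ_def
  have hκ0 : 0 < κ := by positivity
  have hκκ₀ : κ ≤ κ₀ := min_le_left _ _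
  have hκ1 : κ ≤ 1 := (min_le_right _ _).trans (min_le_left _ _)
  have hκη : κ ≤ η / 2 := (min_le_right _ _).trans (min_le_right _ _)
  have hexp2 : Integrable (fun φ => Real.exp (2 * κ * affSize φ)) lam := by
    refine hexp.mono' (by have := measurable_affSize; fun_prop) (ae_of_all _ fun φ => ?_)
    rw [Real.norm_of_nonneg (Real.exp_pos _).le]
    have := affSize_nonneg φ
    gcongr
    linarith
  set β : ℝ := ∫ φ, Real.exp (2 * κ * affSize φ) ∂lam with hβ_def
  have hβ : 1 ≤ β := by
    have := integral_mono (integrable_const (1 : ℝ)) hexp2 fun φ =>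
      Real.one_le_exp (by have := affSize_nonneg φ; positivity)
    simpa using this
  set q : ℝ := 1 - κ * (a / 4) / 2 with hq_def
  have hq1 : q < 1 := by have := mul_pos hκ0 ha; linarith
  obtain ⟨hmi, hmle⟩ := hκ κ hκ0 hκκ₀ (fun φ => Real.log φ.1.1) measurable_log_dilation
    (fun φ => by
      have h1 := abs_log_dilation_le φ
      have h2 := affSize_nonneg φ
      linarith) (by linarith)
  have hq0 : 0 < q := (integral_exp_pos hmi).trans_le hmle
  set V : ℝ → ℝ := fun y => Real.exp (-κ * (Real.log (1 + |y|) + h y)) with hV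
  have hV0 : ∀ y, 0 < V y := fun y => Real.exp_pos _
  set L : ℝ → AffP → ℝ := fun y φ => (Real.log (1 + |pull φ y|) - Real.log (1 + |y|))
    + (h (pull φ y) - h y) with hL
  have hLmeas : ∀ y, Measurable (L y) := fun y =>
    ((measurable_log_one_add_abs.comp (measurable_pull_left y)).sub measurable_const).add
      ((hmeas.comp (measurable_pull_left y)).sub measurable_const)
  have hLbound : ∀ y φ, |L y φ| ≤ affSize φ + B := fun y φ => by
    have h1 := abs_le.1 (abs_log_pull_sub_le φ y)
    have h2 := hbd (pull φ y)
    have h3 := hbd y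
    rw [abs_le]
    simp only [hL]
    constructor <;> linarith
  have hLint : ∀ y, Integrable (L y) lam := fun y =>
    (hl.add (integrable_const B)).mono' (hLmeas y).aestronglyMeasurable
      (ae_of_all _ (hLbound y))
  have hVL : ∀ y (φ : AffP) (t : ℝ), φ.1.1 ^ (-(κ * t)) * V (pull φ y)
      = Real.exp (κ * (-L y φ - t * Real.log φ.1.1)) * V y := fun y φ t => by
    rw [← hdil, hV, hL]
    simp only [← Real.exp_add]
    congr 1
    ring
  have hstep : ∀ t : ℝ, 0 ≤ t → t ≤ 1 / 8 → ∀ y, ∫⁻ φ : AffP,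
      ENNReal.ofReal (φ.1.1 ^ (-(κ * t)) * V (pull φ y)) ∂lam ≤ ENNReal.ofReal (q * V y) := by
    intro t ht ht8 y
    obtain ⟨hi, hle⟩ := hκ κ hκ0 hκκ₀ (fun φ => -L y φ - t * Real.log φ.1.1)
      ((hLmeas y).neg.sub (measurable_log_dilation.const_mul t)) (fun φ => by
        have h1 := abs_le.1 (hLbound y φ)
        have h2 := abs_le.1 (abs_log_dilation_le φ)
        have h3 := affSize_nonneg φ
        rw [abs_le]
        constructor <;> nlinarith) (by
        have hnL : Integrable (fun φ => -L y φ) lam := (hLint y).neg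
        rw [integral_sub hnL (hlog.const_mul t), integral_const_mul, hmean,
          integral_neg]
        have := hLdrift y
        simp only [hL]
        nlinarith)
    exact lintegral_ofReal_mul_le hi (fun φ => (Real.exp_pos _).le) (hV0 y).le hle
      fun φ => (hVL y φ t).le
  set K : ℝ := max (Real.exp (κ * B) * β) (β / (1 - q)) with hK
  have hKβ : Real.exp (κ * B) * β ≤ K := le_max_left _ _
  have hexpB : 1 ≤ Real.exp (κ * B) := Real.one_le_exp (by positivity)
  have hKB : Real.exp (κ * B) ≤ K := (le_mul_of_one_le_right (by positivity) hβ).trans hKβ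
  refine ⟨κ, hκ0, hκ1, q, hq0, hq1, K, hexpB.trans hKB, V, ?_, fun y => ?_, fun y => ?_,
    fun y => ?_, fun y => ?_, fun y => ?_, fun n => ?_⟩
  · exact Real.measurable_exp.comp ((measurable_log_one_add_abs.add hmeas).const_mul _)
  · have hy := abs_nonneg y
    rw [Real.rpow_def_of_pos (by positivity)]
    refine Real.exp_le_exp.2 ?_
    have := (hbd y).2
    nlinarith
  · refine (Real.exp_le_exp.2 ?_).trans hKB
    have h1 := (hbd y).1
    have h2 : 0 ≤ Real.log (1 + |y|) := Real.log_nonneg (by simp)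
    nlinarith
  · simpa using hstep 0 le_rfl (by norm_num) y
  · simpa [div_eq_mul_inv] using hstep (1 / 8) (by norm_num) le_rfl y
  · refine (lintegral_ofReal_mul_le (hexp2.const_mul (Real.exp (κ * B)))
      (fun φ => by positivity) (hV0 y).le (by rw [integral_const_mul]; exact hKβ)
      fun φ => ?_)
    have := hVL y φ 1
    rw [mul_one] at this
    rw [this]
    refine mul_le_mul_of_nonneg_right ?_ (hV0 y).le
    rw [← Real.exp_add]
    refine Real.exp_le_exp.2 ?_
    have h1 := abs_le.1 (hLbound y φ)
    have h2 := abs_le.1 (abs_log_dilation_le φ)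
    nlinarith
  · refine (lintegral_one_add_abs_rpow_iterLaw_le hκ0 hκ1 hq0.le hq1 hβ ?_ ?_ n).trans
      (ENNReal.ofReal_le_ofReal (le_max_right _ _))
    · simpa using lintegral_ofReal_mul_le hmi (fun φ => (Real.exp_pos _).le) zero_le_one hmle
        fun φ => by rw [hdil, mul_one]
    · have := lintegral_ofReal_mul_le (g := fun φ : AffP => (1 + |φ.1.2|) ^ κ) hexp2
        (fun φ => (Real.exp_pos _).le) zero_le_one le_rfl fun φ => by
          have h0 := affSize_nonneg φ
          have hb := abs_nonneg φ.1.2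
          calc (1 + |φ.1.2|) ^ κ ≤ Real.exp (affSize φ) ^ κ :=
                Real.rpow_le_rpow (by positivity) (one_add_abs_le_exp_affSize φ) hκ0.le
            _ = Real.exp (affSize φ * κ) := (Real.exp_mul _ _).symm
            _ ≤ Real.exp (2 * κ * affSize φ) * 1 := by
                rw [mul_one]
                refine Real.exp_le_exp.2 ?_
                nlinarith
      simpa using this

lemma measure_closedBall_le_of_one_le {μ : Measure ℝ} {κ K : ℝ} (hκ : 0 < κ)
    (hμ : ∫⁻ x, ENNReal.ofReal ((1 + |x|) ^ κ) ∂μ ≤ ENNReal.ofReal K) (y : ℝ) {s : ℝ}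
    (hs : 1 ≤ s) :
    μ (Metric.closedBall y s) ≤ ENNReal.ofReal (K * (2 * s) ^ κ * (1 + |y|) ^ (-κ)) := by
  have hy := abs_nonneg y
  have hpos : 0 < ((1 + |y|) / (2 * s)) ^ κ := by positivity
  have hsub : Metric.closedBall y s ⊆ {x | ENNReal.ofReal (((1 + |y|) / (2 * s)) ^ κ)
      ≤ ENNReal.ofReal ((1 + |x|) ^ κ)} := by
    intro x hx
    rw [Metric.mem_closedBall, Real.dist_eq] at hx
    refine ENNReal.ofReal_le_ofReal (Real.rpow_le_rpow (by positivity) ?_ hκ.le)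
    rw [div_le_iff₀ (by positivity)]
    have h1 : |y| ≤ |x| + |x - y| := by
      have := abs_sub_abs_le_abs_sub y x
      rw [abs_sub_comm] at this
      linarith
    nlinarith [abs_nonneg x]
  have hm : Measurable fun x : ℝ => ENNReal.ofReal ((1 + |x|) ^ κ) := by fun_prop
  refine (measure_mono hsub).trans ((meas_ge_le_lintegral_div hm.aemeasurable
    (by simpa using hpos) ENNReal.ofReal_ne_top).trans ?_)
  refine (ENNReal.div_le_div_right hμ _).trans_eq ?_
  rw [← ENNReal.ofReal_div_of_pos hpos]
  congr 1
  rw [Real.div_rpow (by positivity) (by positivity), Real.rpow_neg (by positivity)]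
  field_simp

lemma measure_compl_closedBall_le {μ : Measure ℝ} {κ K : ℝ} (hκ : 0 < κ)
    (hμ : ∫⁻ x, ENNReal.ofReal ((1 + |x|) ^ κ) ∂μ ≤ ENNReal.ofReal K) {R : ℝ} (hR : 0 < R) :
    μ (Metric.closedBall 0 R)ᶜ ≤ ENNReal.ofReal (K * R ^ (-κ)) := by
  have hpos : 0 < R ^ κ := by positivity
  have hsub : (Metric.closedBall 0 R)ᶜ ⊆ {x | ENNReal.ofReal (R ^ κ)
      ≤ ENNReal.ofReal ((1 + |x|) ^ κ)} := by
    intro x hx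
    rw [Set.mem_compl_iff, Metric.mem_closedBall, Real.dist_eq, sub_zero, not_le] at hx
    exact ENNReal.ofReal_le_ofReal (Real.rpow_le_rpow hR.le (by linarith) hκ.le)
  have hm : Measurable fun x : ℝ => ENNReal.ofReal ((1 + |x|) ^ κ) := by fun_prop
  refine (measure_mono hsub).trans ((meas_ge_le_lintegral_div hm.aemeasurable
    (by simpa using hpos) ENNReal.ofReal_ne_top).trans ?_)
  refine (ENNReal.div_le_div_right hμ _).trans_eq ?_
  rw [← ENNReal.ofReal_div_of_pos hpos, Real.rpow_neg hR.le, div_eq_mul_inv]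

lemma iterLaw_closedBall_le_lyapunov {lam : Measure AffP} [IsProbabilityMeasure lam]
    {κ δ q K : ℝ} {V : ℝ → ℝ} (hδ : 0 < δ) (hδκ : δ ≤ κ) (hκ1 : κ ≤ 1) (hq0 : 0 < q)
    (hq1 : q < 1) (hK : 1 ≤ K) (hVm : Measurable V) (hV : ∀ y, (1 + |y|) ^ (-κ) ≤ V y)
    (hstep : ∀ y, ∫⁻ φ : AffP, ENNReal.ofReal (V (pull φ y)) ∂lam ≤ ENNReal.ofReal (q * V y))
    (hstepδ : ∀ y, ∫⁻ φ : AffP, ENNReal.ofReal (φ.1.1 ^ (-δ) * V (pull φ y)) ∂lam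
      ≤ ENNReal.ofReal (q * V y))
    (hstepκ : ∀ y, ∫⁻ φ : AffP, ENNReal.ofReal (φ.1.1 ^ (-κ) * V (pull φ y)) ∂lam
      ≤ ENNReal.ofReal (K * V y))
    (hmoment : ∀ n, ∫⁻ x, ENNReal.ofReal ((1 + |x|) ^ κ) ∂iterLaw lam n ≤ ENNReal.ofReal K)
    (n : ℕ) (y : ℝ) {s : ℝ} (hs : 0 < s) (hs1 : s ≤ 1) :
    iterLaw lam n (Metric.closedBall y s)
      ≤ ENNReal.ofReal ((2 * K * K / (1 - q) * s ^ δ + 2 * q ^ n) * V y) := by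
  have hκ : 0 < κ := hδ.trans_le hδκ
  have h1q : 0 < 1 - q := by linarith
  have hV0 : ∀ y, 0 < V y := fun y =>
    (show 0 < (1 + |y|) ^ (-κ) by have := abs_nonneg y; positivity).trans_le (hV y)
  have h2κ : (2 : ℝ) ^ κ ≤ 2 := by
    simpa using Real.rpow_le_rpow_of_exponent_le one_le_two hκ1
  set C : ℝ := 2 * K * K / (1 - q) with hC
  have hC0 : 0 < C := by positivity
  have hCq : C * q + 2 * K * K = C := by
    rw [hC]; field_simp; ring
  induction n generalizing y s with
  | zero =>
    rw [iterLaw, Measure.dirac_apply' _ measurableSet_closedBall]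
    by_cases h0 : (0 : ℝ) ∈ Metric.closedBall y s
    · rw [Set.indicator_of_mem h0, Pi.one_apply, ENNReal.one_le_ofReal]
      rw [Metric.mem_closedBall, Real.dist_eq, zero_sub, abs_neg] at h0
      have h2 : (1 / 2 : ℝ) ≤ V y := by
        refine le_trans ?_ (hV y)
        rw [Real.rpow_neg (by positivity), ← one_div]
        refine one_div_le_one_div_of_le (by positivity) (le_trans ?_ h2κ)
        exact Real.rpow_le_rpow (by positivity) (by linarith) hκ.le
      have h3 : 0 ≤ C * s ^ δ := by positivity
      rw [pow_zero]
      nlinarith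
    · rw [Set.indicator_of_notMem h0]
      exact zero_le
  | succ n ih =>
    have hVp : Measurable fun φ : AffP => V (pull φ y) := hVm.comp (measurable_pull_left y)
    have hmδ : Measurable fun φ : AffP => ENNReal.ofReal (φ.1.1 ^ (-δ) * V (pull φ y)) :=
      ((measurable_dilation.pow_const _).mul hVp).ennreal_ofReal
    have hsplit : ∀ φ : AffP, iterLaw lam n (Metric.closedBall (pull φ y) (s / φ.1.1))
        ≤ ENNReal.ofReal (C * s ^ δ) * ENNReal.ofReal (φ.1.1 ^ (-δ) * V (pull φ y))
          + ENNReal.ofReal (2 * q ^ n) * ENNReal.ofReal (V (pull φ y))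
          + ENNReal.ofReal (2 * K * s ^ δ) * ENNReal.ofReal (φ.1.1 ^ (-κ) * V (pull φ y)) := by
      intro φ
      have hr := φ.2
      have hVφ := hV0 (pull φ y)
      have hdiv : ∀ t : ℝ, (s / φ.1.1) ^ t = s ^ t * φ.1.1 ^ (-t) := fun t => by
        rw [Real.div_rpow hs.le hr.le, Real.rpow_neg hr.le, div_eq_mul_inv]
      rcases le_total (s / φ.1.1) 1 with h | h
      · refine (ih (pull φ y) (div_pos hs hr) h).trans (le_add_right (le_of_eq ?_))
        rw [hdiv, ← ENNReal.ofReal_mul (by positivity), ← ENNReal.ofReal_mul (by positivity),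
          ← ENNReal.ofReal_add (by positivity) (by positivity)]
        congr 1
        ring
      · refine (measure_closedBall_le_of_one_le hκ (hmoment n) (pull φ y) h).trans
          (le_add_left ?_)
        rw [← ENNReal.ofReal_mul (by positivity)]
        refine ENNReal.ofReal_le_ofReal ?_
        have hsκ : s ^ κ ≤ s ^ δ := Real.rpow_le_rpow_of_exponent_ge hs hs1 hδκ
        calc K * (2 * (s / φ.1.1)) ^ κ * (1 + |pull φ y|) ^ (-κ)
            ≤ K * (2 * (s ^ δ * φ.1.1 ^ (-κ))) * V (pull φ y) := by
              rw [Real.mul_rpow (by norm_num) (by positivity), hdiv]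
              gcongr
              exact hV _
          _ = _ := by ring
    rw [iterLaw_succ_apply lam n measurableSet_closedBall]
    simp_rw [preimage_closedBall]
    refine (lintegral_mono hsplit).trans ?_
    have hVy := hV0 y
    have hsum : Measurable fun φ : AffP =>
        ENNReal.ofReal (C * s ^ δ) * ENNReal.ofReal (φ.1.1 ^ (-δ) * V (pull φ y))
          + ENNReal.ofReal (2 * q ^ n) * ENNReal.ofReal (V (pull φ y)) :=
      (hmδ.const_mul _).add (hVp.ennreal_ofReal.const_mul _)
    rw [lintegral_add_left hsum, lintegral_add_left (hmδ.const_mul _), lintegral_const_mul' _ _ ENNReal.ofReal_ne_top,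
      lintegral_const_mul' _ _ ENNReal.ofReal_ne_top,
      lintegral_const_mul' _ _ ENNReal.ofReal_ne_top]
    calc _ ≤ ENNReal.ofReal (C * s ^ δ) * ENNReal.ofReal (q * V y)
          + ENNReal.ofReal (2 * q ^ n) * ENNReal.ofReal (q * V y)
          + ENNReal.ofReal (2 * K * s ^ δ) * ENNReal.ofReal (K * V y) := by
          gcongr
          · exact hstepδ y
          · exact hstep y
          · exact hstepκ y
      _ = _ := by
          rw [← ENNReal.ofReal_mul (by positivity), ← ENNReal.ofReal_mul (by positivity),
            ← ENNReal.ofReal_mul (by positivity), ← ENNReal.ofReal_add (by positivity)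
            (by positivity), ← ENNReal.ofReal_add (by positivity) (by positivity)]
          congr 1
          rw [pow_succ]
          linear_combination s ^ δ * V y * hCq

lemma exists_iterLaw_closedBall_le {lam : Measure AffP} [IsProbabilityMeasure lam]
    (hmom : ∃ ε : ℝ, 0 < ε ∧
      ∫⁻ φ : AffP, ENNReal.ofReal (φ.1.1 ^ ε + φ.1.1 ^ (-ε) + |φ.1.2| ^ ε) ∂lam < ⊤)
    (hnofix : ¬ ∃ t : ℝ, ∀ φ ∈ msupport lam, φ.1.1 * t + φ.1.2 = t)
    {σ : Measure ℝ} [IsProbabilityMeasure σ]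
    (hstat : ∀ A : Set ℝ, MeasurableSet A →
      σ A = ∫⁻ φ : AffP, σ ((fun t => φ.1.1 * t + φ.1.2) ⁻¹' A) ∂lam) :
    ∃ δ : ℝ, 0 < δ ∧ ∃ q : ℝ, 0 < q ∧ q < 1 ∧ ∃ C : ℝ, 0 < C ∧ ∀ n : ℕ,
      (∀ y s : ℝ, 0 < s → s ≤ 1 →
        iterLaw lam n (Metric.closedBall y s) ≤ ENNReal.ofReal (C * (s ^ δ + q ^ n))) ∧
      ∀ R : ℝ, 0 < R → iterLaw lam n (Metric.closedBall 0 R)ᶜ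
        ≤ ENNReal.ofReal (C * R ^ (-(8 * δ))) := by
  obtain ⟨κ, hκ, hκ1, q, hq0, hq1, K, hK, V, hVm, hV, hVK, h0, hδ, hκK, hm⟩ :=
    exists_lyapunov hmom hnofix hstat
  have h1q : 0 < 1 - q := by linarith
  refine ⟨κ / 8, by positivity, q, hq0, hq1, (2 * K * K / (1 - q) + 2) * K, by positivity,
    fun n => ⟨fun y s hs hs1 => ?_, fun R hR => ?_⟩⟩
  · refine (iterLaw_closedBall_le_lyapunov (by positivity) (by linarith) hκ1 hq0 hq1 hK hVm hV
      h0 hδ hκK hm n y hs hs1).trans (ENNReal.ofReal_le_ofReal ?_)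
    have hsδ : 0 < s ^ (κ / 8) := by positivity
    have hqn : 0 < q ^ n := by positivity
    have hA : 0 < 2 * K * K / (1 - q) := by positivity
    calc (2 * K * K / (1 - q) * s ^ (κ / 8) + 2 * q ^ n) * V y
        ≤ ((2 * K * K / (1 - q) + 2) * (s ^ (κ / 8) + q ^ n)) * K := by
          refine mul_le_mul ?_ (hVK y) ?_ (by positivity)
          · nlinarith [mul_pos hA hqn]
          · exact (show 0 < (1 + |y|) ^ (-κ) by
              have := abs_nonneg y; positivity).le.trans (hV y)
      _ = _ := by ring
  · refine (measure_compl_closedBall_le hκ (hm n) hR).trans (ENNReal.ofReal_le_ofReal ?_)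
    have e : 8 * (κ / 8) = κ := by ring
    rw [e]
    have hA : 0 < 2 * K * K / (1 - q) := by positivity
    gcongr
    nlinarith

/-- Lagrange interpolation: a normalised quadratic polynomial cannot be small at three
separated points. -/
lemma one_le_of_quadratic_le {a b c x y z ρ R d : ℝ} (h : max |a| (max |b| |c|) = 1)
    (hR : 1 ≤ R) (hd : 0 < d) (hx : |x| ≤ R) (hy : |y| ≤ R) (hz : |z| ≤ R)
    (hfx : |a * x ^ 2 + b * x + c| ≤ ρ) (hfy : |a * y ^ 2 + b * y + c| ≤ ρ)
    (hfz : |a * z ^ 2 + b * z + c| ≤ ρ)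
    (hxy : d ≤ |x - y|) (hxz : d ≤ |x - z|) (hyz : d ≤ |y - z|) :
    d ^ 2 ≤ 6 * ρ * R ^ 2 := by
  have hρ : 0 ≤ ρ := (abs_nonneg _).trans hfx
  set u : ℝ := (a * x ^ 2 + b * x + c) / ((x - y) * (x - z)) with hu
  set v : ℝ := -(a * y ^ 2 + b * y + c) / ((x - y) * (y - z)) with hv
  set w : ℝ := (a * z ^ 2 + b * z + c) / ((x - z) * (y - z)) with hw
  have hne : ∀ {s t : ℝ}, d ≤ |s - t| → s - t ≠ 0 := fun hst => abs_pos.1 (hd.trans_le hst)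
  have hquot : ∀ {f p q : ℝ}, |f| ≤ ρ → d ≤ |p| → d ≤ |q| → |f / (p * q)| ≤ ρ / d ^ 2 := by
    intro f p q hf hp hq
    rw [abs_div, abs_mul, sq]
    gcongr
  have hu' : |u| ≤ ρ / d ^ 2 := hquot hfx hxy hxz
  have hv' : |v| ≤ ρ / d ^ 2 := hquot (by rwa [abs_neg]) hxy hyz
  have hw' : |w| ≤ ρ / d ^ 2 := hquot hfz hxz hyz
  have n1 := hne hxy
  have n2 := hne hxz
  have n3 := hne hyz
  have ha : a = u + v + w := by
    rw [hu, hv, hw]; field_simp; ring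
  have hb : b = -(u * (y + z) + v * (x + z) + w * (x + y)) := by
    rw [hu, hv, hw]; field_simp; ring
  have hc : c = u * (y * z) + v * (x * z) + w * (x * y) := by
    rw [hu, hv, hw]; field_simp; ring
  set E : ℝ := ρ / d ^ 2 with hE
  have hE0 : 0 ≤ E := by positivity
  have hbound : ∀ {p q r T : ℝ}, |p| ≤ T → |q| ≤ T → |r| ≤ T →
      |u * p + v * q + w * r| ≤ 3 * E * T := by
    intro p q r T hp hq hr
    have e1 : |u * p| ≤ E * T := by rw [abs_mul]; gcongr
    have e2 : |v * q| ≤ E * T := by rw [abs_mul]; gcongr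
    have e3 : |w * r| ≤ E * T := by rw [abs_mul]; gcongr
    have := abs_add_three (u * p) (v * q) (w * r)
    linarith
  have hadd : ∀ {s t : ℝ}, |s| ≤ R → |t| ≤ R → |s + t| ≤ 2 * R := fun hs ht =>
    (abs_add_le _ _).trans (by linarith)
  have hmul : ∀ {s t : ℝ}, |s| ≤ R → |t| ≤ R → |s * t| ≤ R ^ 2 := fun hs ht => by
    rw [abs_mul, sq]
    gcongr
  have hER : 3 * E * 1 ≤ 6 * E * R ^ 2 := by nlinarith [mul_nonneg hE0 (sub_nonneg.2 hR)]
  have hER2 : 3 * E * (2 * R) ≤ 6 * E * R ^ 2 := by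
    nlinarith [mul_nonneg hE0 (sub_nonneg.2 hR)]
  have hER3 : 3 * E * R ^ 2 ≤ 6 * E * R ^ 2 := by nlinarith [mul_nonneg hE0 (sq_nonneg R)]
  have ha' : |a| ≤ 6 * E * R ^ 2 := by
    have := hbound (p := 1) (q := 1) (r := 1) (T := 1) (by simp) (by simp) (by simp)
    rw [mul_one, mul_one, mul_one, ← ha] at this
    linarith
  have hb' : |b| ≤ 6 * E * R ^ 2 := by
    rw [hb, abs_neg]
    exact (hbound (hadd hy hz) (hadd hx hz) (hadd hx hy)).trans hER2
  have hc' : |c| ≤ 6 * E * R ^ 2 := by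
    rw [hc]
    exact (hbound (hmul hy hz) (hmul hx hz) (hmul hx hy)).trans hER3
  have hone : (1 : ℝ) ≤ 6 * E * R ^ 2 := by
    rw [← h]
    exact max_le ha' (max_le hb' hc')
  have hEd : E * d ^ 2 = ρ := by rw [hE]; field_simp
  calc d ^ 2 ≤ 6 * E * R ^ 2 * d ^ 2 := le_mul_of_one_le_left (by positivity) hone
    _ = 6 * ρ * R ^ 2 := by rw [← hEd]; ring

lemma quadratic_sublevel_inter_closedBall_subset {a b c ρ R d : ℝ}
    (h : max |a| (max |b| |c|) = 1) (hR : 1 ≤ R) (hd : 0 < d) (hlt : 6 * ρ * R ^ 2 < d ^ 2) :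
    ∃ x y : ℝ, {s : ℝ | |a * s ^ 2 + b * s + c| ≤ ρ} ∩ Metric.closedBall 0 R
      ⊆ Metric.closedBall x d ∪ Metric.closedBall y d := by
  set A : Set ℝ := {s : ℝ | |a * s ^ 2 + b * s + c| ≤ ρ} ∩ Metric.closedBall 0 R with hA
  by_cases h1 : ∃ x, x ∈ A
  · obtain ⟨x, hx⟩ := h1
    by_cases h2 : ∃ y, y ∈ A ∧ d ≤ |x - y|
    · obtain ⟨y, hy, hxy⟩ := h2
      refine ⟨x, y, fun z hz => ?_⟩
      by_contra hcon
      simp only [Set.mem_union, Metric.mem_closedBall, Real.dist_eq, not_or, not_le] at hcon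
      simp only [hA, Set.mem_inter_iff, Set.mem_ofPred_eq, Metric.mem_closedBall, Real.dist_eq,
        sub_zero] at hx hy hz
      refine hlt.not_ge (one_le_of_quadratic_le h hR hd hx.2 hy.2 hz.2 hx.1 hy.1 hz.1 hxy ?_ ?_)
      · rw [abs_sub_comm]; exact hcon.1.le
      · rw [abs_sub_comm]; exact hcon.2.le
    · push Not at h2
      refine ⟨x, x, fun z hz => Or.inl ?_⟩
      rw [Metric.mem_closedBall, dist_comm, Real.dist_eq]
      exact (h2 z hz).le
  · push Not at h1
    exact ⟨0, 0, fun z hz => (h1 z hz).elim⟩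

/-- Non-concentration of `σ⁽ⁿ⁾` near quadratic curves: for normalized `(a,b,c)` and scales
`ρ ∈ [e^{-n}, 1)`, the mass of `{s : |a s² + b s + c| ≤ ρ}` is at most `C ρ^κ`. -/
theorem iterLaw_quadratic_nonconcentration
    (lam : Measure AffP) [IsProbabilityMeasure lam]
    (hmom : ∃ ε : ℝ, 0 < ε ∧
      ∫⁻ φ : AffP, ENNReal.ofReal (φ.1.1 ^ ε + φ.1.1 ^ (-ε) + |φ.1.2| ^ ε) ∂lam < ⊤)
    (hnofix : ¬ ∃ t : ℝ, ∀ φ ∈ msupport lam, φ.1.1 * t + φ.1.2 = t)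
    (σ : Measure ℝ) [IsProbabilityMeasure σ]
    (hstat : ∀ A : Set ℝ, MeasurableSet A →
      σ A = ∫⁻ φ : AffP, σ ((fun t => φ.1.1 * t + φ.1.2) ⁻¹' A) ∂lam) :
    ∃ κ : ℝ, 0 < κ ∧ ∃ C : ℝ, 0 < C ∧
      ∀ n : ℕ, 1 ≤ n → ∀ ρ : ℝ, Real.exp (-(n : ℝ)) ≤ ρ → ρ < 1 →
        ∀ a b c : ℝ, max |a| (max |b| |c|) = 1 →
          iterLaw lam n {s : ℝ | |a * s ^ 2 + b * s + c| ≤ ρ} ≤ ENNReal.ofReal (C * ρ ^ κ) := by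
  obtain ⟨δ, hδ, q, hq0, hq1, C, hC, hbound⟩ := exists_iterLaw_closedBall_le hmom hnofix hstat
  have hlogq : 0 < -Real.log q := neg_pos.2 (Real.log_neg hq0 hq1)
  set κ : ℝ := min (δ / 4) (-Real.log q) with hκ
  have hκ0 : 0 < κ := by positivity
  have hκδ : κ ≤ δ / 4 := min_le_left _ _
  have hκq : κ ≤ -Real.log q := min_le_right _ _
  refine ⟨κ, hκ0, 5 * C + 1296 ^ κ, by positivity, fun n _ ρ hnρ hρ1 a b c habc => ?_⟩
  have hprob := iterLaw_isProbabilityMeasure lam n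
  have hρ0 : 0 < ρ := (Real.exp_pos _).trans_le hnρ
  have hρκ : 0 < ρ ^ κ := by positivity
  by_cases hbig : 1 / 1296 ≤ ρ
  · refine prob_le_one.trans (ENNReal.one_le_ofReal.2 ?_)
    have h1 : (1 : ℝ) ≤ 1296 ^ κ * ρ ^ κ := by
      rw [← Real.mul_rpow (by norm_num) hρ0.le]
      exact Real.one_le_rpow (by linarith) hκ0.le
    nlinarith
  · push Not at hbig
    have hqn : q ^ n ≤ ρ ^ κ := by
      calc q ^ n = Real.exp (-n) ^ (-Real.log q) := by
            rw [← Real.exp_mul, ← Real.rpow_natCast, Real.rpow_def_of_pos hq0]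
            congr 1
            ring
        _ ≤ ρ ^ (-Real.log q) := Real.rpow_le_rpow (Real.exp_pos _).le hnρ hlogq.le
        _ ≤ ρ ^ κ := Real.rpow_le_rpow_of_exponent_ge hρ0 hρ1.le hκq
    set d : ℝ := ρ ^ (1 / 4 : ℝ) with hd
    set R : ℝ := ρ ^ (-(1 / 8) : ℝ) with hR
    have hd0 : 0 < d := by positivity
    have hR0 : 0 < R := by positivity
    have hd1 : d ≤ 1 := Real.rpow_le_one hρ0.le hρ1.le (by norm_num)
    have hR1 : 1 ≤ R := Real.one_le_rpow_of_pos_of_le_one_of_nonpos hρ0 hρ1.le (by norm_num)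
    have hd6 : 6 * d < 1 := by
      have : d < (1 / 1296 : ℝ) ^ (1 / 4 : ℝ) := Real.rpow_lt_rpow hρ0.le hbig (by norm_num)
      have e : (1 / 1296 : ℝ) ^ (1 / 4 : ℝ) = 1 / 6 := by
        rw [show (1 / 1296 : ℝ) = (1 / 6) ^ (4 : ℝ) by norm_num,
          ← Real.rpow_mul (by norm_num)]
        norm_num
      linarith
    have hρd : ρ * R ^ 2 = d ^ 3 := by
      rw [hR, hd, ← Real.rpow_natCast, ← Real.rpow_natCast, ← Real.rpow_mul hρ0.le,
        ← Real.rpow_mul hρ0.le]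
      nth_rewrite 1 [← Real.rpow_one ρ]
      rw [← Real.rpow_add hρ0]
      norm_num
    have hsep : 6 * ρ * R ^ 2 < d ^ 2 := by
      calc 6 * ρ * R ^ 2 = 6 * d * d ^ 2 := by rw [mul_assoc, hρd]; ring
        _ < 1 * d ^ 2 := by gcongr
        _ = d ^ 2 := one_mul _
    obtain ⟨x, y, hxy⟩ := quadratic_sublevel_inter_closedBall_subset habc hR1 hd0 hsep
    have hball : ∀ z, iterLaw lam n (Metric.closedBall z d)
        ≤ ENNReal.ofReal (2 * C * ρ ^ κ) := fun z => by
      refine ((hbound n).1 z d hd0 hd1).trans (ENNReal.ofReal_le_ofReal ?_)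
      have hdκ : d ^ δ ≤ ρ ^ κ := by
        rw [hd, ← Real.rpow_mul hρ0.le]
        exact Real.rpow_le_rpow_of_exponent_ge hρ0 hρ1.le (by linarith)
      nlinarith
    have htail : iterLaw lam n (Metric.closedBall 0 R)ᶜ ≤ ENNReal.ofReal (C * ρ ^ κ) := by
      refine ((hbound n).2 R hR0).trans (ENNReal.ofReal_le_ofReal ?_)
      have hRκ : R ^ (-(8 * δ)) ≤ ρ ^ κ := by
        rw [hR, ← Real.rpow_mul hρ0.le]
        exact Real.rpow_le_rpow_of_exponent_ge hρ0 hρ1.le (by linarith)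
      gcongr
    have hcover : {s : ℝ | |a * s ^ 2 + b * s + c| ≤ ρ} ⊆
        (Metric.closedBall x d ∪ Metric.closedBall y d) ∪ (Metric.closedBall 0 R)ᶜ := by
      intro s hs
      by_cases hsR : s ∈ Metric.closedBall (0 : ℝ) R
      · exact Or.inl (hxy ⟨hs, hsR⟩)
      · exact Or.inr hsR
    calc iterLaw lam n {s : ℝ | |a * s ^ 2 + b * s + c| ≤ ρ}
        ≤ iterLaw lam n (Metric.closedBall x d) + iterLaw lam n (Metric.closedBall y d)
          + iterLaw lam n (Metric.closedBall 0 R)ᶜ :=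
          (measure_mono hcover).trans ((measure_union_le _ _).trans
            (by gcongr; exact measure_union_le _ _))
      _ ≤ ENNReal.ofReal (2 * C * ρ ^ κ) + ENNReal.ofReal (2 * C * ρ ^ κ)
          + ENNReal.ofReal (C * ρ ^ κ) := by
          gcongr
          · exact hball x
          · exact hball y
      _ ≤ ENNReal.ofReal ((5 * C + 1296 ^ κ) * ρ ^ κ) := by
          rw [← ENNReal.ofReal_add (by positivity) (by positivity),
            ← ENNReal.ofReal_add (by positivity) (by positivity)]
          refine ENNReal.ofReal_le_ofReal ?_
          have : (0 : ℝ) < 1296 ^ κ * ρ ^ κ := by positivity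
          nlinarith
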